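/- arXiv:1902.02526 — 3 statements merged into one kernel-verified Lean document; each statement's English description precedes it below -/
import Mathlib

section
/- Let ℓ ≥ 2 be an integer. Every simple undirected graph G with n vertices and more than (n−1)·ℓ/2 edges contains a cycle of length at least ℓ+1 (i.e., a cycle with at least ℓ+1 vertices). -/
open Finset

namespace SimpleGraph

variable {V : Type*} {G : SimpleGraph V}

/-- A path given by its list of vertices, together with a chord from its first vertex to a
later vertex `u` which is not its successor, contains a cycle through all the vertices up to `u`. -/
theorem exists_isCycle_of_isChain {w u : V} {l₁ l₂ : List V}
    (hc : (w :: (l₁ ++ u :: l₂)).IsChain G.Adj) (hn : (w :: (l₁ ++ u :: l₂)).Nodup)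
    (hwu : G.Adj w u) (hl : l₁ ≠ []) :
    ∃ (v : V) (c : G.Walk v v), c.IsCycle ∧ c.length = l₁.length + 2 := by
  have heq : w :: (l₁ ++ u :: l₂) = w :: (l₁ ++ [u]) ++ l₂ := by simp
  rw [heq] at hc hn
  obtain ⟨p, hp⟩ : ∃ p : G.Walk w u, p.support = w :: (l₁ ++ [u]) := by
    exact ⟨(Walk.ofSupport _ (List.cons_ne_nil w _) hc.left_of_append).copy rfl (by simp),
      (Walk.support_copy _ _ _).trans (Walk.support_ofSupport _ _)⟩
  have hpath : p.IsPath := by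
    rw [Walk.isPath_def, hp]
    exact hn.of_append_left
  have hlen : p.length = l₁.length + 1 := by
    have := p.length_support
    rw [hp] at this
    simpa using this.symm
  refine ⟨u, Walk.cons hwu.symm p, (Walk.cons_isCycle_iff _ _).2 ⟨hpath, fun he ↦ ?_⟩,
    by simp [hlen]⟩
  have h₁ := hpath.length_eq_one_of_mem_edges (Sym2.eq_swap ▸ he)
  have := List.length_pos_iff.2 hl
  omega

/-- Pósa rotation: a chord from the first vertex of a path to the vertex `x` allows us to reverse
the part of the path preceding `x`. -/
theorem isChain_rotate {w x p : V} {l₁ l₂ l : List V} (h : w :: l = l₁ ++ p :: x :: l₂)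
    (hc : (w :: l).IsChain G.Adj) (hwx : G.Adj w x) :
    (p :: (l₁.reverse ++ x :: l₂)).IsChain G.Adj := by
  have h₁ : (l₁ ++ [p]) ++ x :: l₂ = w :: l := by simp [h]
  rw [← h₁, List.isChain_append] at hc
  have h₂ : p :: (l₁.reverse ++ x :: l₂) = (l₁ ++ [p]).reverse ++ x :: l₂ := by simp
  rw [h₂, List.isChain_append]
  refine ⟨?_, hc.2.1, ?_⟩
  · rw [List.isChain_reverse]
    simpa only [G.adj_comm] using hc.1
  · have h₃ : (l₁ ++ [p]).head? = some w := by
      have := congrArg List.head? h₁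
      rw [List.head?_append_of_ne_nil _ (by simp)] at this
      simpa using this
    rw [List.getLast?_reverse, h₃]
    simpa using hwx

/-- In a list without duplicates, the successor of an entry is unique. -/
theorem _root_.List.Nodup.eq_of_append_cons_cons {α : Type*} {p x y : α} {l₁ l₂ m₁ m₂ : List α}
    (hn : (l₁ ++ p :: x :: l₂).Nodup) (h : l₁ ++ p :: x :: l₂ = m₁ ++ p :: y :: m₂) : x = y := by
  induction l₁ generalizing m₁ with
  | nil => cases m₁ <;> simp_all
  | cons a l₁ ih => cases m₁ <;> grind

section

variable [DecidableEq V] [DecidableRel G.Adj]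

/-- If a graph has no cycle longer than `ℓ`, then the set of first vertices of the paths obtained
by rotating a longest path meets few edges. -/
theorem exists_subset_forall_card_adj_le {ℓ : ℕ} (hℓ : 2 ≤ ℓ)
    (hG : ∀ (v : V) (c : G.Walk v v), c.IsCycle → c.length ≤ ℓ) {U : Finset V}
    (hU : U.Nonempty) :
    ∃ S ⊆ U, S.Nonempty ∧ #S ≤ ℓ ∧
      ∀ w ∈ S, #{x ∈ U | G.Adj w x} + #{x ∈ U \ S | G.Adj w x} ≤ ℓ := by
  classical
  let P : List V → Prop := fun L ↦ L.IsChain G.Adj ∧ L.Nodup ∧ ∀ x ∈ L, x ∈ U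
  have hPlen : ∀ L, P L → L.length ≤ #U := fun L hL ↦ by
    rw [← List.toFinset_card_of_nodup hL.2.1]
    exact card_le_card fun x hx ↦ hL.2.2 x (List.mem_toFinset.1 hx)
  obtain ⟨L, ⟨hLc, hLn, hLU⟩, hmax⟩ : ∃ L, P L ∧ ∀ L', P L' → L'.length ≤ L.length := by
    have h := Nat.findGreatest_spec (P := fun n ↦ ∃ L, P L ∧ L.length = n) (Nat.zero_le #U)
      ⟨[], by simp [P], rfl⟩
    obtain ⟨L, hL, hlen⟩ := h
    refine ⟨L, hL, fun L' hL' ↦ ?_⟩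
    rw [hlen]
    exact Nat.le_findGreatest (hPlen L' hL') ⟨L', hL', rfl⟩
  have hL0 : 0 < L.length := by
    obtain ⟨a, ha⟩ := hU
    exact hmax [a] ⟨by simp, by simp, by simpa using ha⟩
  obtain ⟨B, A, rfl, hBℓ, hA⟩ : ∃ B A, L = B ++ A ∧ B.length ≤ ℓ ∧ (A ≠ [] → B.length = ℓ) := by
    refine ⟨L.take ℓ, L.drop ℓ, by simp, by simp, fun h ↦ ?_⟩
    have : ¬ L.length ≤ ℓ := fun h' ↦ h (List.drop_eq_nil_of_le h')
    simp
    omega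
  let S : Finset V := {w ∈ U | ∃ C, (w :: C).Perm B ∧ (w :: (C ++ A)).IsChain G.Adj}
  have hPF : ∀ {w C}, (w :: C).Perm B → (w :: (C ++ A)).IsChain G.Adj → P (w :: (C ++ A)) := by
    intro w C hp hc
    have hp' : (w :: (C ++ A)).Perm (B ++ A) := hp.append_right A
    exact ⟨hc, hp'.nodup_iff.2 hLn, fun x hx ↦ hLU x (hp'.mem_iff.1 hx)⟩
  have hSB : S ⊆ B.toFinset := by
    intro w hw
    obtain ⟨-, C, hp, -⟩ := mem_filter.1 hw
    exact List.mem_toFinset.2 (hp.mem_iff.1 (by simp))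
  have hBcard : #B.toFinset ≤ ℓ := (List.toFinset_card_le _).trans hBℓ
  refine ⟨S, filter_subset _ _, ?_, (card_le_card hSB).trans hBcard, fun w hw ↦ ?_⟩
  · cases B with
    | nil =>
      have : A ≠ [] := by rintro rfl; simp at hL0
      have := hA this
      simp at this
      omega
    | cons b C => exact ⟨b, mem_filter.2 ⟨hLU b (by simp), C, .rfl, hLc⟩⟩
  obtain ⟨hwU, C, hp, hc⟩ := mem_filter.1 hw
  obtain ⟨-, hn, hCU⟩ := hPF hp hc
  have hlen : C.length + 1 = B.length := by simpa using hp.length_eq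
  have hNB : ∀ x ∈ U, G.Adj w x → x ∈ C := by
    intro x hxU hwx
    have hx : x ∈ w :: (C ++ A) := by
      by_contra hx
      have := hmax (x :: w :: (C ++ A)) ⟨hc.cons_cons hwx.symm, hn.cons hx, by
        simpa [hxU] using hCU⟩
      simp at this
      omega
    simp only [List.mem_cons, hwx.ne.symm, false_or, List.mem_append] at hx
    refine hx.resolve_right fun hxA ↦ ?_
    have hBl := hA (List.ne_nil_of_mem hxA)
    obtain ⟨A₁, A₂, rfl⟩ := List.append_of_mem hxA
    rw [← List.append_assoc] at hc hn
    obtain ⟨v, c, hcyc, hcl⟩ := exists_isCycle_of_isChain hc hn hwx (by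
      apply List.ne_nil_of_length_pos
      simp
      omega)
    have := hG v c hcyc
    simp at hcl
    omega
  have h₁ : #{x ∈ U | G.Adj w x} ≤ #S := by
    refine card_le_card_of_forall_subsingleton
      (fun x p ↦ ∃ l₁ l₂, w :: C = l₁ ++ p :: x :: l₂) (fun x hx ↦ ?_) ?_
    · obtain ⟨hxU, hwx⟩ := mem_filter.1 hx
      obtain ⟨C₁, C₂, hC⟩ := List.append_of_mem (hNB x hxU hwx)
      obtain ⟨l₁, p, hl⟩ : ∃ l₁ p, w :: C₁ = l₁ ++ [p] :=
        ⟨_, _, (List.dropLast_append_getLast (List.cons_ne_nil w C₁)).symm⟩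
      have hwC : w :: C = l₁ ++ p :: x :: C₂ := by
        rw [hC, ← List.cons_append, hl]
        simp
      refine ⟨p, mem_filter.2 ⟨hCU p ?_, l₁.reverse ++ x :: C₂, ?_, ?_⟩, l₁, C₂, hwC⟩
      · rw [← List.cons_append, hwC]
        simp
      · refine List.Perm.trans ?_ hp
        rw [hwC]
        exact ((l₁.reverse_perm.append_right _).cons p).trans List.perm_middle.symm
      · have := isChain_rotate (l := C ++ A) (l₂ := C₂ ++ A) (l₁ := l₁) (p := p)
          (by rw [← List.cons_append, hwC]; simp) hc hwx
        simpa using this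
    · rintro p - x ⟨-, l₁, l₂, hx⟩ y ⟨-, m₁, m₂, hy⟩
      have hn' : (w :: C).Nodup := by
        rw [← List.cons_append] at hn
        exact hn.of_append_left
      exact List.Nodup.eq_of_append_cons_cons (hx ▸ hn') (hx.symm.trans hy)
  have h₂ : #{x ∈ U \ S | G.Adj w x} ≤ #(B.toFinset \ S) := by
    refine card_le_card fun x hx ↦ ?_
    simp only [mem_filter, mem_sdiff] at hx
    exact mem_sdiff.2 ⟨List.mem_toFinset.2 (hp.mem_iff.1
      (List.mem_cons_of_mem _ (hNB x hx.1.1 hx.2))), hx.1.2⟩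
  rw [card_sdiff_of_subset hSB] at h₂
  have := card_le_card hSB
  omega

theorem sum_card_adj_eq_add_sum_sdiff {S U : Finset V} (hSU : S ⊆ U) :
    ∑ a ∈ U, #{x ∈ U | G.Adj a x} = ∑ a ∈ U \ S, #{x ∈ U \ S | G.Adj a x} +
      ∑ w ∈ S, (#{x ∈ U | G.Adj w x} + #{x ∈ U \ S | G.Adj w x}) := by
  have h₁ : ∀ a, #{x ∈ U | G.Adj a x} = #{x ∈ U \ S | G.Adj a x} + #{x ∈ S | G.Adj a x} := by
    intro a
    rw [← card_union_of_disjoint (disjoint_filter_filter sdiff_disjoint), ← filter_union,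
      sdiff_union_of_subset hSU]
  have h₂ : ∑ a ∈ U \ S, #{x ∈ S | G.Adj a x} = ∑ w ∈ S, #{x ∈ U \ S | G.Adj w x} := by
    have := sum_card_bipartiteAbove_eq_sum_card_bipartiteBelow (s := U \ S) (t := S) G.Adj
    simpa only [bipartiteAbove, bipartiteBelow, G.adj_comm] using this
  rw [← sum_sdiff hSU, sum_congr rfl fun a (_ : a ∈ U \ S) ↦ h₁ a, sum_add_distrib, h₂,
    sum_add_distrib]
  ring

/-- **Erdős–Gallai**, for the subgraph induced on a finite set `U`: without cycles longer than `ℓ`,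
the degrees inside `U` sum to at most `(#U - 1) * ℓ`. -/
theorem sum_card_adj_le {ℓ : ℕ} (hℓ : 2 ≤ ℓ)
    (hG : ∀ (v : V) (c : G.Walk v v), c.IsCycle → c.length ≤ ℓ) (U : Finset V) :
    ∑ a ∈ U, #{x ∈ U | G.Adj a x} ≤ (#U - 1) * ℓ := by
  induction U using Finset.strongInduction with
  | H U ih =>
    obtain hle | hlt := le_or_gt #U ℓ
    · calc ∑ a ∈ U, #{x ∈ U | G.Adj a x} ≤ ∑ _a ∈ U, (#U - 1) := by
            refine sum_le_sum fun a ha ↦ ?_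
            rw [← card_erase_of_mem ha]
            refine card_le_card fun x hx ↦ ?_
            obtain ⟨hxU, hax⟩ := mem_filter.1 hx
            exact mem_erase.2 ⟨hax.ne.symm, hxU⟩
        _ = (#U - 1) * #U := by simp [mul_comm]
        _ ≤ (#U - 1) * ℓ := Nat.mul_le_mul_left _ hle
    · obtain ⟨S, hSU, hSne, hSℓ, hS⟩ :=
        exists_subset_forall_card_adj_le hℓ hG (card_pos.1 (by omega : 0 < #U))
      calc ∑ a ∈ U, #{x ∈ U | G.Adj a x}
          ≤ (#(U \ S) - 1) * ℓ + ∑ _w ∈ S, ℓ := by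
            rw [sum_card_adj_eq_add_sum_sdiff hSU]
            exact Nat.add_le_add (ih _ (sdiff_ssubset hSU hSne)) (sum_le_sum hS)
        _ = (#(U \ S) - 1 + #S) * ℓ := by simp [add_mul]
        _ = (#U - 1) * ℓ := by
            rw [card_sdiff_of_subset hSU]
            congr 1
            omega

end

end SimpleGraph

/-- **Erdős–Gallai.** Every graph with `n` vertices and more than `(n-1)·ℓ/2` edges
(`ℓ ≥ 2`), i.e. with `2·|E| > (n-1)·ℓ`, contains a cycle of length at least `ℓ + 1`. -/
theorem erdos_gallai_cycle {V : Type*} [Fintype V] (G : SimpleGraph V) (ℓ : ℕ) (hℓ : 2 ≤ ℓ)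
    (hE : (Fintype.card V - 1) * ℓ < 2 * G.edgeSet.ncard) :
    ∃ (v : V) (c : G.Walk v v), c.IsCycle ∧ ℓ + 1 ≤ c.length := by
  classical
  by_contra! hG
  have h := SimpleGraph.sum_card_adj_le hℓ (fun v c hc ↦ Nat.le_of_lt_succ (hG v c hc)) Finset.univ
  have hdeg := G.sum_degrees_eq_twice_card_edges
  simp only [← SimpleGraph.card_neighborFinset_eq_degree, SimpleGraph.neighborFinset_eq_filter]
    at hdeg
  rw [hdeg, Finset.card_univ, ← Set.ncard_coe_finset, SimpleGraph.coe_edgeFinset] at h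
  omega
end

section
/- (Dirac) Every 2-connected graph G on n vertices with minimum degree δ(G) ≥ 2 contains a cycle with at least min{2·δ(G), n} vertices. -/
/-- A graph is 2-connected if it is connected and deleting any single vertex
leaves it connected. -/
def SimpleGraph.TwoConnected {V : Type*} (G : SimpleGraph V) : Prop :=
  G.Connected ∧ ∀ v : V, (G.induce ({v}ᶜ : Set V)).Connected

namespace SimpleGraph

variable {V : Type*} {G : SimpleGraph V}

/-- There is a path of `G` from `u` to `v` whose vertex set is exactly `S`. -/
def HasPathOn (G : SimpleGraph V) (u v : V) (S : Set V) : Prop :=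
  ∃ W : G.Walk u v, W.IsPath ∧ ∀ z, z ∈ W.support ↔ z ∈ S

/-- There is a walk of `G` from `u` to `v` none of whose vertices, apart from `u` and `v`,
lies in `X`. -/
def ReachableOff (G : SimpleGraph V) (X : Set V) (u v : V) : Prop :=
  ∃ W : G.Walk u v, ∀ z ∈ W.support, z = u ∨ z = v ∨ z ∉ X

namespace HasPathOn

variable {u v w v' : V} {S T : Set V}

theorem left_mem (h : G.HasPathOn u v S) : u ∈ S := by
  obtain ⟨W, -, hS⟩ := h
  exact (hS u).1 W.start_mem_support

theorem singleton (u : V) : G.HasPathOn u u {u} :=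
  ⟨.nil, .nil, by simp⟩

theorem symm (h : G.HasPathOn u v S) : G.HasPathOn v u S := by
  obtain ⟨W, hW, hS⟩ := h
  exact ⟨W.reverse, hW.reverse, by simpa using hS⟩

theorem right_mem (h : G.HasPathOn u v S) : v ∈ S := h.symm.left_mem

theorem trans (h : G.HasPathOn u v S) (h' : G.HasPathOn v w T)
    (hST : ∀ z ∈ S, z ∈ T → z = v) : G.HasPathOn u w (S ∪ T) := by
  obtain ⟨W, hW, hS⟩ := h
  obtain ⟨W', hW', hT⟩ := h'
  refine ⟨W.append W', ?_, fun z ↦ ?_⟩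
  · rw [Walk.isPath_def, Walk.support_append]
    have hnd := hW'.support_nodup
    rw [← Walk.cons_tail_support, List.nodup_cons] at hnd
    refine hW.support_nodup.append hnd.2 fun z hz hz' ↦ ?_
    have := hST z ((hS z).1 hz) ((hT z).1 (List.mem_of_mem_tail hz'))
    exact hnd.1 (this ▸ hz')
  · rw [Walk.mem_support_append_iff, hS, hT, Set.mem_union]

theorem cons (h : G.Adj u v) (h' : G.HasPathOn v w T) (hu : u ∉ T) :
    G.HasPathOn u w (insert u T) := by
  obtain ⟨W, hW, hT⟩ := h'
  refine ⟨.cons h W, hW.cons (by rwa [hT]), fun z ↦ ?_⟩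
  rw [Walk.support_cons, List.mem_cons, hT, Set.mem_insert_iff]

theorem join (h : G.HasPathOn u v S) (hadj : G.Adj v v') (h' : G.HasPathOn v' w T)
    (hST : ∀ z ∈ S, z ∉ T) : G.HasPathOn u w (S ∪ T) := by
  have := h.trans (h'.cons hadj (hST v h.right_mem)) fun z hz hz' ↦
    hz'.resolve_right (hST z hz)
  rwa [Set.union_insert, Set.insert_eq_of_mem (Set.mem_union_left _ h.right_mem)] at this

theorem ncard_eq {W : G.Walk u v} (hW : W.IsPath) (hS : ∀ z, z ∈ W.support ↔ z ∈ S) :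
    S.ncard = W.length + 1 := by
  classical
  have : S = (W.support.toFinset : Set V) := by ext z; simp [hS]
  rw [this, Set.ncard_coe_finset, List.toFinset_card_of_nodup hW.support_nodup,
    Walk.length_support]

/-- Closing a path on at least three vertices by an edge gives a cycle. -/
theorem exists_isCycle (h : G.HasPathOn u v S) (hadj : G.Adj v u) (h3 : 3 ≤ S.ncard) :
    ∃ c : G.Walk v v, c.IsCycle ∧ c.length = S.ncard := by
  obtain ⟨W, hW, hS⟩ := h
  have hcard := ncard_eq hW hS
  refine ⟨.cons hadj W, ?_, by simp [hcard]⟩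
  rw [Walk.cons_isCycle_iff]
  refine ⟨hW, fun he ↦ ?_⟩
  have := hW.length_eq_one_of_mem_edges (Sym2.eq_swap ▸ he)
  omega

/-- A path whose ends are adjacent can be reopened at each of its vertices. -/
theorem exists_rotate (h : G.HasPathOn u v S) (hadj : G.Adj v u) {y : V} (hy : y ∈ S) :
    ∃ z, G.HasPathOn z y S := by
  classical
  obtain ⟨W, hW, hS⟩ := h
  have hy' := (hS y).2 hy
  have hspec := W.take_spec hy'
  have hA := hW.takeUntil hy'
  have hB := hW.dropUntil hy'
  revert hspec hA hB
  generalize W.takeUntil y hy' = A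
  generalize W.dropUntil y hy' = B
  intro hspec hA hB
  cases B with
  | nil => exact ⟨u, W, hW, hS⟩
  | @cons _ z _ hz B =>
    rw [Walk.cons_isPath_iff] at hB
    have h1 : G.HasPathOn z v {t | t ∈ B.support} := ⟨B, hB.1, fun _ ↦ Iff.rfl⟩
    have h2 : G.HasPathOn u y {t | t ∈ A.support} := ⟨A, hA, fun _ ↦ Iff.rfl⟩
    have hnd := hW.support_nodup
    rw [← hspec, Walk.support_append, Walk.support_cons, List.tail_cons,
      List.nodup_append] at hnd
    refine ⟨z, ?_⟩
    convert h1.join hadj h2 fun t ht ht' ↦ hnd.2.2 t ht' t ht rfl using 1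
    ext t
    rw [← hS, ← hspec, Walk.support_append, Walk.support_cons, List.tail_cons,
      List.mem_append, Set.mem_union, or_comm]
    rfl

end HasPathOn

namespace ReachableOff

variable {X : Set V} {u v w : V}

theorem trans (h : G.ReachableOff X u v) (h' : G.ReachableOff X v w) (hv : v ∉ X) :
    G.ReachableOff X u w := by
  obtain ⟨W, hW⟩ := h
  obtain ⟨W', hW'⟩ := h'
  refine ⟨W.append W', fun z hz ↦ ?_⟩
  rcases (Walk.mem_support_append_iff _ _).1 hz with hz | hz
  · rcases hW z hz with rfl | rfl | h <;> tauto
  · rcases hW' z hz with rfl | rfl | h <;> tauto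

theorem of_adj (h : G.Adj u v) : G.ReachableOff X u v :=
  ⟨h.toWalk, by simp +contextual [or_imp]⟩

theorem exists_hasPathOn (h : G.ReachableOff X u v) :
    ∃ T, G.HasPathOn u v T ∧ ∀ z ∈ T, z = u ∨ z = v ∨
      (z ∉ X ∧ G.ReachableOff X u z ∧ G.ReachableOff X z v) := by
  classical
  obtain ⟨W, hW⟩ := h
  have hP := W.bypass_isPath
  have hWP : ∀ z ∈ W.bypass.support, z = u ∨ z = v ∨ z ∉ X :=
    fun z hz ↦ hW z (W.support_bypass_subset_support hz)
  revert hP hWP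
  generalize W.bypass = P
  intro hP hWP
  refine ⟨{z | z ∈ P.support}, ⟨P, hP, fun _ ↦ Iff.rfl⟩, fun z (hz : z ∈ P.support) ↦ ?_⟩
  by_cases hzu : z = u
  · exact .inl hzu
  by_cases hzv : z = v
  · exact .inr (.inl hzv)
  have hzX : z ∉ X := by have := hWP z hz; tauto
  have hnd := hP.support_nodup
  rw [← P.take_spec hz, Walk.support_append, List.nodup_append] at hnd
  have hdrop := (P.dropUntil z hz).cons_tail_support.symm
  refine .inr (.inr ⟨hzX, ⟨P.takeUntil z hz, fun t ht ↦ ?_⟩, ⟨P.dropUntil z hz, fun t ht ↦ ?_⟩⟩)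
  · rcases hWP t (P.support_takeUntil_subset_support hz ht) with h | rfl | h
    · exact .inl h
    · have := (P.dropUntil z hz).end_mem_support
      rw [hdrop, List.mem_cons] at this
      exact (hnd.2.2 t ht t (this.resolve_left (Ne.symm hzv)) rfl).elim
    · exact .inr (.inr h)
  · rcases hWP t (P.support_dropUntil_subset_support hz ht) with rfl | h | h
    · rw [hdrop, List.mem_cons] at ht
      exact (hnd.2.2 t (Walk.start_mem_support _) t (ht.resolve_left (Ne.symm hzu)) rfl).elim
    · exact .inr (.inl h)
    · exact .inr (.inr h)

end ReachableOff

/-- The vertices `x 0, …, x k` are distinct and consecutive ones are adjacent. -/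
structure IsPathSeq (G : SimpleGraph V) (x : ℕ → V) (k : ℕ) : Prop where
  injOn : Set.InjOn x (Set.Iic k)
  adj : ∀ i < k, G.Adj (x i) (x (i + 1))

namespace IsPathSeq

variable {x : ℕ → V} {k i j m : ℕ} {u v : V} {S : Set V}

theorem eq_of_eq (hx : G.IsPathSeq x k) (hi : i ≤ k) (hj : j ≤ k) (h : x i = x j) : i = j :=
  hx.injOn hi hj h

theorem hasPathOn (hx : G.IsPathSeq x k) (hij : i ≤ j) (hj : j ≤ k) :
    G.HasPathOn (x i) (x j) (x '' Set.Icc i j) := by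
  induction j, hij using Nat.le_induction with
  | base => simpa using HasPathOn.singleton (x i)
  | succ j hij ih =>
    have := (ih (by omega)).join (hx.adj j (by omega)) (.singleton _) <| by
      rintro _ ⟨l, ⟨h1, h2⟩, rfl⟩ h
      have := hx.eq_of_eq (by omega) hj h
      omega
    convert this using 1
    rw [← Set.image_singleton, ← Set.image_union]
    congr 1
    ext l
    simp only [Set.mem_Icc, Set.mem_union, Set.mem_singleton_iff]
    omega

theorem card_le_ncard [Finite V] (hx : G.IsPathSeq x k) {I : Finset ℕ}
    (hI : ∀ i ∈ I, i ≤ k ∧ x i ∈ S) : I.card ≤ S.ncard := by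
  have hinj : Set.InjOn x I := fun i hi j hj h ↦ hx.eq_of_eq (hI i hi).1 (hI j hj).1 h
  rw [← Set.ncard_coe_finset, ← hinj.ncard_image]
  refine Set.ncard_le_ncard ?_
  rintro _ ⟨i, hi, rfl⟩
  exact (hI i hi).2

/-- Deleting an inner vertex of the path, one can still get across it. -/
theorem exists_reachableOff (hx : G.IsPathSeq x k)
    (h2c : ∀ v : V, (G.induce ({v}ᶜ : Set V)).Connected) (hm : 0 < m) (hmk : m < k) :
    ∃ j < m, ∃ r, m < r ∧ r ≤ k ∧ G.ReachableOff (x '' Set.Iic k) (x j) (x r) := by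
  have key : ∀ (a b : ({x m}ᶜ : Set V)) (W : (G.induce ({x m}ᶜ : Set V)).Walk a b),
      (b : V) = x k →
      (∃ j < m, (a : V) = x j ∨
        ((a : V) ∉ x '' Set.Iic k ∧ G.ReachableOff (x '' Set.Iic k) (x j) a)) →
      ∃ j < m, ∃ r, m < r ∧ r ≤ k ∧ G.ReachableOff (x '' Set.Iic k) (x j) (x r) := by
    intro a b W hb
    induction W with
    | nil =>
      rintro ⟨j, hj, h | h⟩
      · have := hx.eq_of_eq le_rfl (by omega) (hb ▸ h)
        omega
      · exact absurd ⟨k, Set.self_mem_Iic, hb.symm⟩ h.1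
    | @cons a c b hac W ih =>
      rintro ⟨j, hj, h⟩
      have hac' : G.Adj a c := hac
      have hjc : G.ReachableOff (x '' Set.Iic k) (x j) c := by
        rcases h with h | ⟨h, h'⟩
        · exact h ▸ .of_adj hac'
        · exact h'.trans (.of_adj hac') h
      by_cases hc : (c : V) ∈ x '' Set.Iic k
      · obtain ⟨l, hl, hlc⟩ := hc
        rcases lt_trichotomy l m with hlm | rfl | hlm
        · exact ih hb ⟨l, hlm, .inl hlc.symm⟩
        · exact absurd hlc.symm c.2
        · exact ⟨j, hj, l, hlm, hl, hlc ▸ hjc⟩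
      · exact ih hb ⟨j, hj, .inr ⟨hc, hjc⟩⟩
  have h0 : x 0 ≠ x m := fun h ↦ by have := hx.eq_of_eq (by omega) hmk.le h; omega
  have hk : x k ≠ x m := fun h ↦ by have := hx.eq_of_eq le_rfl hmk.le h; omega
  obtain ⟨W⟩ := (h2c (x m)).preconnected ⟨x 0, h0⟩ ⟨x k, hk⟩
  exact key _ _ W rfl ⟨0, hm, .inl rfl⟩

/-- Among the ears of the path which jump over `x m`, there is one reaching as far as possible. -/
theorem exists_maximal_ear (hx : G.IsPathSeq x k)
    (h2c : ∀ v : V, (G.induce ({v}ᶜ : Set V)).Connected) (hm : 0 < m) (hmk : m < k) :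
    ∃ j < m, ∃ r, m < r ∧ r ≤ k ∧
      (∃ T, G.HasPathOn (x j) (x r) T ∧ ∀ z ∈ T, z = x j ∨ z = x r ∨
        (z ∉ x '' Set.Iic k ∧ G.ReachableOff (x '' Set.Iic k) (x j) z ∧
          G.ReachableOff (x '' Set.Iic k) z (x r))) ∧
      ∀ i < m, ∀ s ≤ k, G.ReachableOff (x '' Set.Iic k) (x i) (x s) → s ≤ r := by
  classical
  obtain ⟨j, hj, r, hr, hrk, h⟩ := hx.exists_reachableOff h2c hm hmk
  let P : ℕ → Prop := fun r ↦ m < r ∧ ∃ j < m, G.ReachableOff (x '' Set.Iic k) (x j) (x r)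
  have hP : P (Nat.findGreatest P k) := Nat.findGreatest_spec hrk ⟨hr, j, hj, h⟩
  obtain ⟨hlt, j', hj', h'⟩ := hP
  refine ⟨j', hj', _, hlt, Nat.findGreatest_le k, h'.exists_hasPathOn, fun i hi s hs his ↦ ?_⟩
  by_cases hms : m < s
  · exact Nat.le_findGreatest hs ⟨hms, i, hi, his⟩
  · omega

end IsPathSeq

/-- A path with vertex set `S` from `x p` to `x q` which, apart from `x q`, uses no vertex of the
path `x 0, …, x k` beyond `x p`, and whose end `x q` lies as far as an ear attached before `x p`
can reach. -/
structure IsVine (G : SimpleGraph V) (x : ℕ → V) (k p q : ℕ) (S : Set V) : Prop where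
  lt : p < q
  le : q ≤ k
  hasPathOn : G.HasPathOn (x p) (x q) S
  mem : ∀ z ∈ S, (∃ i ≤ p, z = x i) ∨ z = x q ∨
    (z ∉ x '' Set.Iic k ∧ ∃ i < p, G.ReachableOff (x '' Set.Iic k) (x i) z)
  maximal : ∀ i < p, ∀ s ≤ k, G.ReachableOff (x '' Set.Iic k) (x i) (x s) → s ≤ q

namespace IsVine

variable {x : ℕ → V} {k p q b : ℕ} {S : Set V}

theorem eq_of_mem (h : G.IsVine x k p q S) (hx : G.IsPathSeq x k) {i : ℕ} (hi : i ≤ k)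
    (hiS : x i ∈ S) : i ≤ p ∨ i = q := by
  rcases h.mem _ hiS with ⟨j, hj, hij⟩ | hiq | ⟨hX, -⟩
  · have := h.lt
    have := h.le
    exact .inl ((hx.eq_of_eq hi (by omega) hij).trans_le hj)
  · exact .inr (hx.eq_of_eq hi h.le hiq)
  · exact absurd ⟨i, hi, rfl⟩ hX

theorem extend (h : G.IsVine x k p q S) (hx : G.IsPathSeq x k)
    (h2c : ∀ v : V, (G.induce ({v}ᶜ : Set V)).Connected) (hq : q < k) :
    ∃ r S', G.IsVine x k q r S' ∧ S ⊆ S' := by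
  have hpq := h.lt
  obtain ⟨j, hj, r, hr, hrk, ⟨T, hT, hTmem⟩, hmax⟩ := hx.exists_maximal_ear h2c (by omega) hq
  have hjr : G.ReachableOff (x '' Set.Iic k) (x j) (x r) := by
    obtain ⟨W, hW, hWT⟩ := hT
    refine ⟨W, fun z hz ↦ ?_⟩
    have := hTmem z ((hWT z).1 hz)
    tauto
  have hpj : p ≤ j := by
    by_contra hlt
    have := h.maximal j (by omega) r hrk hjr
    omega
  have h1 := h.hasPathOn.symm.trans (hx.hasPathOn hpj (by omega)) <| by
    rintro _ hz ⟨i, ⟨hpi, hij⟩, rfl⟩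
    have := h.eq_of_mem hx (by omega) hz
    rw [show i = p by omega]
  have h2 := h1.trans hT <| by
    rintro z hz hzT
    rcases hTmem z hzT with rfl | rfl | ⟨hzX, -, hzr⟩
    · rfl
    · rcases hz with hz | ⟨i, ⟨hpi, hij⟩, hir⟩
      · have := h.eq_of_mem hx hrk hz
        omega
      · have := hx.eq_of_eq (by omega) hrk hir
        omega
    · rcases hz with hz | ⟨i, ⟨hpi, hij⟩, rfl⟩
      · rcases h.mem z hz with ⟨i, hi, rfl⟩ | rfl | ⟨-, i, hi, hiz⟩
        · exact absurd ⟨i, (by simp; omega), rfl⟩ hzX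
        · exact absurd ⟨q, hq.le, rfl⟩ hzX
        · have := h.maximal i hi r hrk (hiz.trans hzr hzX)
          omega
      · exact absurd ⟨i, (by simp; omega), rfl⟩ hzX
  refine ⟨r, _, ⟨hr, hrk, h2, ?_, hmax⟩, fun z hz ↦ .inl (.inl hz)⟩
  rintro z ((hz | ⟨i, ⟨hpi, hij⟩, rfl⟩) | hz)
  · rcases h.mem z hz with ⟨i, hi, rfl⟩ | rfl | ⟨hzX, i, hi, hiz⟩
    · exact .inl ⟨i, by omega, rfl⟩
    · exact .inl ⟨q, le_rfl, rfl⟩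
    · exact .inr (.inr ⟨hzX, i, by omega, hiz⟩)
  · exact .inl ⟨i, by omega, rfl⟩
  · rcases hTmem z hz with rfl | rfl | ⟨hzX, hjz, -⟩
    · exact .inl ⟨j, hj.le, rfl⟩
    · exact .inr (.inl rfl)
    · exact .inr (.inr ⟨hzX, j, hj, hjz⟩)

theorem exists_extend_past {p q : ℕ} {S : Set V} (h : G.IsVine x k p q S) (hx : G.IsPathSeq x k)
    (h2c : ∀ v : V, (G.induce ({v}ᶜ : Set V)).Connected) (hpb : p ≤ b) (hbk : b < k) :
    ∃ p' q' S', G.IsVine x k p' q' S' ∧ S ⊆ S' ∧ p' ≤ b ∧ b < q' := by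
  by_cases hq : b < q
  · exact ⟨p, q, S, h, subset_rfl, hpb, hq⟩
  · obtain ⟨r, S', h', hS⟩ := h.extend hx h2c (by omega)
    have := h'.lt
    obtain ⟨p', q', S'', h'', hS', hb⟩ := h'.exists_extend_past hx h2c (by omega) hbk
    exact ⟨p', q', S'', h'', hS.trans hS', hb⟩
termination_by k - q
decreasing_by omega

end IsVine

namespace IsPathSeq

variable {x : ℕ → V} {k a b : ℕ}

/-- If the neighbours of `x 0` on the path end with `x a`, there is a vine starting at `x a` and
containing all of them. -/
theorem exists_isVine (hx : G.IsPathSeq x k)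
    (h2c : ∀ v : V, (G.induce ({v}ᶜ : Set V)).Connected) (ha : G.Adj (x 0) (x a)) (hak : a < k)
    (hmax : ∀ i ≤ k, G.Adj (x 0) (x i) → i ≤ a) :
    ∃ q S, G.IsVine x k a q S ∧ x 0 ∈ S ∧ ∀ i ≤ k, G.Adj (x 0) (x i) → x i ∈ S := by
  classical
  have ha0 : 0 < a := Nat.pos_of_ne_zero fun h ↦ G.loopless.irrefl _ (h ▸ ha)
  obtain ⟨j, hj, r, hr, hrk, ⟨T, hT, hTmem⟩, hTmax⟩ := hx.exists_maximal_ear h2c ha0 hak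
  have hex : ∃ s, j < s ∧ G.Adj (x 0) (x s) := ⟨a, hj, ha⟩
  obtain ⟨hjs, hs⟩ := Nat.find_spec hex
  have hmin : ∀ i, j < i → G.Adj (x 0) (x i) → Nat.find hex ≤ i :=
    fun i h1 h2 ↦ Nat.find_min' hex ⟨h1, h2⟩
  revert hjs hs hmin
  generalize Nat.find hex = s
  intro hjs hs hmin
  have hsa : s ≤ a := hmin a hj ha
  have h1 := (hx.hasPathOn hsa hak.le).symm.join hs.symm
    (hx.hasPathOn (Nat.zero_le j) (by omega)) <| by
      rintro _ ⟨i, ⟨hsi, hia⟩, rfl⟩ ⟨l, ⟨-, hlj⟩, hli⟩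
      have := hx.eq_of_eq (by omega) (by omega) hli
      omega
  have h2 := h1.trans hT <| by
    intro z hz hzT
    obtain ⟨i, hia, rfl⟩ : ∃ i ≤ a, z = x i := by
      rcases hz with ⟨i, ⟨hsi, hia⟩, rfl⟩ | ⟨i, ⟨-, hij⟩, rfl⟩
      · exact ⟨i, hia, rfl⟩
      · exact ⟨i, by omega, rfl⟩
    rcases hTmem _ hzT with h | h | h
    · exact h
    · have := hx.eq_of_eq (by omega) hrk h
      omega
    · exact absurd ⟨i, (by simp; omega), rfl⟩ h.1
  refine ⟨r, _, ⟨hr, hrk, h2, ?_, hTmax⟩, .inl (.inr ⟨0, by simp, rfl⟩), fun i hi h0i ↦ .inl ?_⟩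
  · rintro z ((⟨i, ⟨hsi, hia⟩, rfl⟩ | ⟨i, ⟨-, hij⟩, rfl⟩) | hz)
    · exact .inl ⟨i, hia, rfl⟩
    · exact .inl ⟨i, by omega, rfl⟩
    · rcases hTmem z hz with rfl | rfl | ⟨hzX, hjz, -⟩
      · exact .inl ⟨j, hj.le, rfl⟩
      · exact .inr (.inl rfl)
      · exact .inr (.inr ⟨hzX, j, hj, hjz⟩)
  · by_cases hij : i ≤ j
    · exact .inr ⟨i, ⟨Nat.zero_le i, hij⟩, rfl⟩
    · exact .inl ⟨i, ⟨hmin i (by omega) h0i, hmax i hi h0i⟩, rfl⟩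

/-- If no neighbour of `x k` precedes a neighbour of `x 0`, then some path with adjacent ends
contains `x 0` and `x k` together with all their neighbours on the given path. -/
theorem exists_hasPathOn_of_le (hx : G.IsPathSeq x k)
    (h2c : ∀ v : V, (G.induce ({v}ᶜ : Set V)).Connected)
    (ha : G.Adj (x 0) (x a)) (hamax : ∀ i ≤ k, G.Adj (x 0) (x i) → i ≤ a)
    (hb : G.Adj (x k) (x b)) (hbmin : ∀ i ≤ k, G.Adj (x k) (x i) → b ≤ i)
    (hab : a ≤ b) (hbk : b < k) :
    ∃ u v S, G.HasPathOn u v S ∧ G.Adj v u ∧ x 0 ∈ S ∧ x k ∈ S ∧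
      ∀ i ≤ k, G.Adj (x 0) (x i) ∨ G.Adj (x k) (x i) → x i ∈ S := by
  classical
  obtain ⟨q₀, S₀, hV₀, h0, hN₀⟩ := hx.exists_isVine h2c ha (by omega) hamax
  obtain ⟨p, q, S, hV, hSS, hpb, hbq⟩ := hV₀.exists_extend_past hx h2c hab hbk
  have hqk := hV.le
  let P : ℕ → Prop := fun i ↦ i < q ∧ G.Adj (x k) (x i)
  obtain ⟨hcq, hc⟩ : P (Nat.findGreatest P k) := Nat.findGreatest_spec hbk.le ⟨hbq, hb⟩
  have hcmax : ∀ i ≤ k, P i → i ≤ Nat.findGreatest P k := fun i hi h ↦ Nat.le_findGreatest hi h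
  revert hcq hc hcmax
  generalize Nat.findGreatest P k = c
  intro hcq hc hcmax
  have hbc : b ≤ c := hcmax b hbk.le ⟨hbq, hb⟩
  have h1 := (hx.hasPathOn (hpb.trans hbc) (by omega)).symm.trans hV.hasPathOn <| by
    rintro _ ⟨i, ⟨hpi, hic⟩, rfl⟩ hiS
    have := hV.eq_of_mem hx (by omega) hiS
    rw [show i = p by omega]
  have h2 := h1.trans (hx.hasPathOn hqk le_rfl) <| by
    rintro _ hz ⟨i, ⟨hqi, hik⟩, rfl⟩
    rcases hz with ⟨l, ⟨hpl, hlc⟩, hli⟩ | hz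
    · have := hx.eq_of_eq (by omega) hik hli
      omega
    · have := hV.eq_of_mem hx hik hz
      have := hV.lt
      rw [show i = q by omega]
  refine ⟨_, _, _, h2, hc, .inl (.inr (hSS h0)), .inr ⟨k, ⟨hqk, le_rfl⟩, rfl⟩, ?_⟩
  rintro i hi (h | h)
  · exact .inl (.inr (hSS (hN₀ i hi h)))
  · by_cases hiq : i < q
    · exact .inl (.inl ⟨i, ⟨hpb.trans (hbmin i hi h), hcmax i hi ⟨hiq, h⟩⟩, rfl⟩)
    · exact .inr ⟨i, ⟨by omega, hi⟩, rfl⟩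

end IsPathSeq

/-- No path of `G` has more vertices than the path `x 0, …, x k`. -/
def IsLongestPathSeq (G : SimpleGraph V) (x : ℕ → V) (k : ℕ) : Prop :=
  G.IsPathSeq x k ∧ ∀ u v S, G.HasPathOn u v S → S.ncard ≤ k + 1

theorem exists_isLongestPathSeq [Finite V] [Nonempty V] (G : SimpleGraph V) :
    ∃ x k, G.IsLongestPathSeq x k := by
  obtain ⟨⟨u, v, S⟩, ⟨W, hW, hS⟩, hmax⟩ := Set.exists_max_image
    {t : V × V × Set V | G.HasPathOn t.1 t.2.1 t.2.2} (fun t ↦ t.2.2.ncard) (Set.toFinite _)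
    ⟨(Classical.arbitrary V, Classical.arbitrary V, _), .singleton (Classical.arbitrary V)⟩
  refine ⟨W.getVert, W.length, ⟨hW.getVert_injOn, fun i hi ↦ W.adj_getVert_succ hi⟩,
    fun u' v' S' h ↦ ?_⟩
  rw [← HasPathOn.ncard_eq hW hS]
  exact hmax (u', v', S') h

namespace IsLongestPathSeq

variable [Finite V] {x : ℕ → V} {k : ℕ} {u v : V} {S : Set V}

theorem mem_of_adj_left (hx : G.IsLongestPathSeq x k) (h : G.HasPathOn u v S)
    (hS : k + 1 ≤ S.ncard) {w : V} (hw : G.Adj u w) : w ∈ S := by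
  by_contra hwS
  have := hx.2 _ _ _ (h.cons hw.symm hwS)
  rw [Set.ncard_insert_of_notMem hwS] at this
  omega

theorem minDegree_le_card [Fintype V] [DecidableRel G.Adj] (hx : G.IsLongestPathSeq x k)
    (h : G.HasPathOn u v (x '' Set.Icc 0 k)) :
    G.minDegree ≤ ((Finset.range (k + 1)).filter fun i ↦ G.Adj u (x i)).card := by
  classical
  refine (G.minDegree_le_degree u).trans ?_
  rw [← card_neighborFinset_eq_degree]
  refine le_trans (Finset.card_le_card fun w hw ↦ ?_) (Finset.card_image_le (f := x))
  rw [mem_neighborFinset] at hw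
  have hcard : k + 1 ≤ (x '' Set.Icc 0 k).ncard := by
    rw [← Finset.card_range (k + 1)]
    exact hx.1.card_le_ncard fun i hi ↦
      ⟨Finset.mem_range_succ_iff.1 hi, i, ⟨Nat.zero_le i, Finset.mem_range_succ_iff.1 hi⟩, rfl⟩
  obtain ⟨i, ⟨-, hi⟩, rfl⟩ := hx.mem_of_adj_left h hcard hw
  exact Finset.mem_image.2
    ⟨i, Finset.mem_filter.2 ⟨Finset.mem_range_succ_iff.2 hi, hw⟩, rfl⟩

/-- A path on as many vertices as a longest path whose ends are adjacent is spanning. -/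
theorem eq_univ (hx : G.IsLongestPathSeq x k) (hG : G.Connected) (h : G.HasPathOn u v S)
    (hadj : G.Adj v u) (hS : k + 1 ≤ S.ncard) : S = Set.univ := by
  by_contra hne
  obtain ⟨w, hw⟩ := (Set.ne_univ_iff_exists_notMem S).1 hne
  obtain ⟨W⟩ := hG.preconnected u w
  obtain ⟨d, -, hd, hd'⟩ := W.exists_boundary_dart S h.left_mem hw
  obtain ⟨z, hz⟩ := h.exists_rotate hadj hd
  exact hd' (hx.mem_of_adj_left hz.symm hS d.adj)

end IsLongestPathSeq

/-- If a neighbour of `x k` precedes a neighbour of `x 0` on a longest path, then there is a long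
path with adjacent ends. -/
theorem IsLongestPathSeq.exists_hasPathOn_of_lt [Fintype V] [DecidableRel G.Adj] {x : ℕ → V}
    {k : ℕ} (hx : G.IsLongestPathSeq x k) (hG : G.Connected)
    (hlt : ∃ i j, i < j ∧ j ≤ k ∧ G.Adj (x k) (x i) ∧ G.Adj (x 0) (x j)) :
    ∃ u v S, G.HasPathOn u v S ∧ G.Adj v u ∧
      (2 * G.minDegree ≤ S.ncard ∨ S = Set.univ) := by
  classical
  have hex : ∃ g i, 0 < g ∧ i + g ≤ k ∧ G.Adj (x k) (x i) ∧ G.Adj (x 0) (x (i + g)) := by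
    obtain ⟨i, j, hij, hjk, hki, h0j⟩ := hlt
    refine ⟨j - i, i, by omega, by omega, hki, ?_⟩
    rwa [Nat.add_sub_cancel' hij.le]
  obtain ⟨i, hg, hik, hki, h0i⟩ := Nat.find_spec hex
  have hmin : ∀ s t, s < t → t ≤ k → G.Adj (x k) (x s) → G.Adj (x 0) (x t) →
      Nat.find hex ≤ t - s := fun s t hst htk hs ht ↦
    Nat.find_min' hex ⟨s, by omega, by omega, hs, by rwa [Nat.add_sub_cancel' hst.le]⟩
  revert hg hik h0i hmin
  generalize Nat.find hex = g
  intro hg hik h0i hmin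
  have hpath := (hx.1.hasPathOn (Nat.zero_le i) (by omega)).symm.join h0i
    (hx.1.hasPathOn hik le_rfl) <| by
      rintro _ ⟨l, ⟨-, hli⟩, rfl⟩ ⟨m, ⟨him, hmk⟩, hml⟩
      have := hx.1.eq_of_eq hmk (by omega) hml
      omega
  refine ⟨_, _, _, hpath, hki, ?_⟩
  have hmem : ∀ l ≤ k, l ≤ i ∨ i + g ≤ l →
      l ≤ k ∧ x l ∈ x '' Set.Icc 0 i ∪ x '' Set.Icc (i + g) k := by
    rintro l hl (h | h)
    · exact ⟨hl, .inl ⟨l, ⟨Nat.zero_le l, h⟩, rfl⟩⟩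
    · exact ⟨hl, .inr ⟨l, ⟨h, hl⟩, rfl⟩⟩
  by_cases hg1 : g = 1
  · refine .inr (hx.eq_univ hG hpath hki ?_)
    rw [← Finset.card_range (k + 1)]
    exact hx.1.card_le_ncard fun l hl ↦
      hmem l (Finset.mem_range_succ_iff.1 hl) (by omega)
  · left
    have hfull := hx.1.hasPathOn (Nat.zero_le k) le_rfl
    have h0 := hx.minDegree_le_card hfull
    have hk := hx.minDegree_le_card hfull.symm
    set N₀ := (Finset.range (k + 1)).filter fun l ↦ G.Adj (x 0) (x l) with hN₀
    set Nₖ := (Finset.range (k + 1)).filter fun l ↦ G.Adj (x k) (x l) with hNₖ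
    have hiN : i ∈ Nₖ := by
      rw [hNₖ, Finset.mem_filter, Finset.mem_range]
      exact ⟨by omega, hki⟩
    have hcard : (insert 0 (N₀ ∪ (Nₖ.erase i).image Nat.succ)).card =
        (N₀.card + (Nₖ.card - 1)) + 1 := by
      rw [Finset.card_insert_of_notMem, Finset.card_union_of_disjoint,
        Finset.card_image_of_injective _ Nat.succ_injective, Finset.card_erase_of_mem hiN]
      · rw [Finset.disjoint_left]
        intro l hl hl'
        obtain ⟨s, hs, rfl⟩ := Finset.mem_image.1 hl'
        simp only [hN₀, hNₖ, Finset.mem_filter, Finset.mem_range, Finset.mem_erase] at hl hs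
        have := hmin s s.succ (by omega) (by omega) hs.2.2 hl.2
        omega
      · simp [hN₀]
    have hle : (insert 0 (N₀ ∪ (Nₖ.erase i).image Nat.succ)).card ≤ _ :=
      hx.1.card_le_ncard fun l hl ↦ by
        refine (show l ≤ k ∧ (l ≤ i ∨ i + g ≤ l) from ?_).elim (hmem l)
        rcases Finset.mem_insert.1 hl with rfl | hl
        · omega
        rcases Finset.mem_union.1 hl with hl | hl
        · simp only [hN₀, Finset.mem_filter, Finset.mem_range] at hl
          refine ⟨by omega, ?_⟩
          by_contra hcon
          have := hmin i l (by omega) (by omega) hki hl.2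
          omega
        · obtain ⟨s, hs, rfl⟩ := Finset.mem_image.1 hl
          simp only [hNₖ, Finset.mem_filter, Finset.mem_range, Finset.mem_erase] at hs
          have hsk : s ≠ k := fun h ↦ G.loopless.irrefl _ (h ▸ hs.2.2)
          refine ⟨by omega, ?_⟩
          by_contra hcon
          have := hmin s (i + g) (by omega) hik hs.2.2 h0i
          omega
    omega

theorem TwoConnected.exists_hasPathOn [Fintype V] [DecidableRel G.Adj] (h2c : G.TwoConnected)
    (hδ : 2 ≤ G.minDegree) :
    ∃ u v S, G.HasPathOn u v S ∧ G.Adj v u ∧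
      (2 * G.minDegree ≤ S.ncard ∨ S = Set.univ) := by
  classical
  have := h2c.1.nonempty
  obtain ⟨x, k, hx⟩ := G.exists_isLongestPathSeq
  by_cases hlt : ∃ i j, i < j ∧ j ≤ k ∧ G.Adj (x k) (x i) ∧ G.Adj (x 0) (x j)
  · exact hx.exists_hasPathOn_of_lt h2c.1 hlt
  have hle : ∀ i j, j ≤ k → G.Adj (x k) (x i) → G.Adj (x 0) (x j) → j ≤ i :=
    fun i j hj hi h0 ↦ not_lt.1 fun hij ↦ hlt ⟨i, j, hij, hj, hi, h0⟩
  have hfull := hx.1.hasPathOn (Nat.zero_le k) le_rfl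
  have h0 := hx.minDegree_le_card hfull
  have hk := hx.minDegree_le_card hfull.symm
  set N₀ := (Finset.range (k + 1)).filter fun l ↦ G.Adj (x 0) (x l) with hN₀
  set Nₖ := (Finset.range (k + 1)).filter fun l ↦ G.Adj (x k) (x l) with hNₖ
  have mem₀ : ∀ l, l ∈ N₀ ↔ l ≤ k ∧ G.Adj (x 0) (x l) := by simp [hN₀]
  have memₖ : ∀ l, l ∈ Nₖ ↔ l ≤ k ∧ G.Adj (x k) (x l) := by simp [hNₖ]
  have hne₀ : N₀.Nonempty := Finset.card_pos.1 (by omega)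
  have hneₖ : Nₖ.Nonempty := Finset.card_pos.1 (by omega)
  obtain ⟨a, ha, hamax⟩ := N₀.exists_max_image id hne₀
  obtain ⟨b, hb, hbmin⟩ := Nₖ.exists_min_image id hneₖ
  simp only [id, mem₀, memₖ] at ha hb hamax hbmin
  have hbk : b ≠ k := fun h ↦ G.loopless.irrefl _ (h ▸ hb.2)
  obtain ⟨u, v, S, hS, huv, h0S, hkS, hNS⟩ := hx.1.exists_hasPathOn_of_le h2c.2 ha.2
    (fun i hi h ↦ hamax i ⟨hi, h⟩) hb.2 (fun i hi h ↦ hbmin i ⟨hi, h⟩)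
    (hle b a ha.1 hb.2 ha.2) (by omega)
  refine ⟨u, v, S, hS, huv, .inl ?_⟩
  have hI : (insert 0 N₀ ∪ Nₖ).card ≤ S.ncard := hx.1.card_le_ncard fun l hl ↦ by
    rcases Finset.mem_union.1 hl with hl | hl
    · rcases Finset.mem_insert.1 hl with rfl | hl
      · exact ⟨Nat.zero_le k, h0S⟩
      · exact ⟨((mem₀ l).1 hl).1, hNS l ((mem₀ l).1 hl).1 (.inl ((mem₀ l).1 hl).2)⟩
    · exact ⟨((memₖ l).1 hl).1, hNS l ((memₖ l).1 hl).1 (.inr ((memₖ l).1 hl).2)⟩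
  have hins : (insert 0 N₀).card = N₀.card + 1 := Finset.card_insert_of_notMem (by simp [mem₀])
  have hinter : (insert 0 N₀ ∩ Nₖ).card ≤ 1 := by
    rw [← Finset.card_singleton a]
    refine Finset.card_le_card fun l hl ↦ ?_
    obtain ⟨hl, hl'⟩ := Finset.mem_inter.1 hl
    have hal := hle l a ha.1 ((memₖ l).1 hl').2 ha.2
    rcases Finset.mem_insert.1 hl with rfl | hl
    · simpa [eq_comm] using hal
    · rw [Finset.mem_singleton]
      exact le_antisymm (hamax l ((mem₀ l).1 hl)) hal
  have := Finset.card_union_add_card_inter (insert 0 N₀) Nₖ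
  omega

end SimpleGraph

/-- **Dirac.** Every 2-connected graph `G` on `n` vertices with minimum degree
`δ(G) ≥ 2` contains a cycle with at least `min {2·δ(G), n}` vertices. -/
theorem dirac_cycle {V : Type*} [Fintype V] (G : SimpleGraph V) [DecidableRel G.Adj]
    (h2c : G.TwoConnected) (hδ : 2 ≤ G.minDegree) :
    ∃ (v : V) (c : G.Walk v v), c.IsCycle ∧
      min (2 * G.minDegree) (Fintype.card V) ≤ c.length := by
  obtain ⟨u, v, S, hS, huv, hcard⟩ := h2c.exists_hasPathOn hδ
  have := h2c.1.nonempty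
  have hn : G.minDegree < Fintype.card V := G.minDegree_lt_card
  have hmin : min (2 * G.minDegree) (Fintype.card V) ≤ S.ncard := by
    rcases hcard with h | rfl
    · exact (min_le_left _ _).trans h
    · rw [Set.ncard_univ, Nat.card_eq_fintype_card]
      exact min_le_right _ _
  obtain ⟨c, hc, hlen⟩ := hS.exists_isCycle huv (by omega)
  exact ⟨v, c, hc, hlen ▸ hmin⟩
end

section
/- Let d and k be positive integers, and let G be a connected graph with a d-core H such that d ≥ 5k−3 and d > |V(H)|−k, and set p = d+k−|V(H)| (so p ≥ 1). Then G has a path with at least d+k vertices if and only if G has an extended system of T-segments {P_1,…,P_r} with terminal set T = V(H) such that the total number of vertices of the paths of the system lying in V(G)∖V(H) equals p. -/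
open SimpleGraph

/-- A (simple) path in `G`, packaged with its two end-vertices. -/
structure PathIn {V : Type*} (G : SimpleGraph V) where
  first : V
  last : V
  walk : G.Walk first last
  isPath : walk.IsPath

namespace PathIn

variable {V : Type*} {G : SimpleGraph V}

/-- The vertex set of the path. -/
def verts (P : PathIn G) : Set V := {x | x ∈ P.walk.support}

/-- The internal (non-end) vertices of the path. -/
def internals (P : PathIn G) : Set V := {x | x ∈ P.walk.support.tail.dropLast}

/-- `x` is an end-vertex of the path. -/
def IsEndpoint (P : PathIn G) (x : V) : Prop := x = P.first ∨ x = P.last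

end PathIn

/-- A path `P` is a one-terminal `T`-segment if it has at least 2 vertices, exactly
one of its end-vertices is in `T`, and all its other vertices are outside `T`. -/
def IsOneTerminalSegment {V : Type*} (G : SimpleGraph V) (T : Set V) (P : PathIn G) : Prop :=
  2 ≤ P.walk.support.length ∧
    ((P.first ∈ T ∧ ∀ x ∈ P.walk.support.tail, x ∉ T) ∨
     (P.last ∈ T ∧ ∀ x ∈ P.walk.support.dropLast, x ∉ T))

/-- A path `P` is a two-terminal `T`-segment if it has at least 3 vertices, both of
its end-vertices are in `T`, and all its internal vertices are outside `T`. -/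
def IsTwoTerminalSegment {V : Type*} (G : SimpleGraph V) (T : Set V) (P : PathIn G) : Prop :=
  3 ≤ P.walk.support.length ∧ P.first ∈ T ∧ P.last ∈ T ∧ ∀ x ∈ P.internals, x ∉ T

/-- The union of a family of paths, as a simple graph on the vertices of `G`. -/
def segUnionGraph {V : Type*} {G : SimpleGraph V} {r : ℕ} (P : Fin r → PathIn G) :
    SimpleGraph V :=
  (⨆ i, (P i).walk.toSubgraph).spanningCoe

/-- A linear forest: a graph each of whose connected components is a path,
equivalently (for finite graphs) an acyclic graph of maximum degree at most 2. -/
def IsLinearForest {V : Type*} (F : SimpleGraph V) : Prop :=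
  F.IsAcyclic ∧ ∀ v : V, (F.neighborSet v).ncard ≤ 2

/-- The paths `P i` are pairwise internally vertex-disjoint: a common vertex of two
of the paths must be an end-vertex of both. -/
def InternallyDisjoint {V : Type*} {G : SimpleGraph V} {r : ℕ} (P : Fin r → PathIn G) : Prop :=
  ∀ i j : Fin r, i ≠ j → ∀ x : V, x ∈ (P i).verts → x ∈ (P j).verts →
    (P i).IsEndpoint x ∧ (P j).IsEndpoint x

/-- A system of `T`-segments: a family of two-terminal `T`-segments that are pairwise
internally vertex-disjoint and whose union is a linear forest. -/
def IsSegmentSystem {V : Type*} (G : SimpleGraph V) (T : Set V) {r : ℕ}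
    (P : Fin r → PathIn G) : Prop :=
  (∀ i, IsTwoTerminalSegment G T (P i)) ∧
  InternallyDisjoint P ∧
  IsLinearForest (segUnionGraph P)

/-- An extended system of `T`-segments: (i) at least one and at most two of the paths
are one-terminal `T`-segments and the remaining ones are two-terminal `T`-segments;
(ii) the paths are pairwise internally vertex-disjoint and the end-vertex outside `T`
of each one-terminal segment is distinct from all other vertices of the paths;
(iii) the union of the paths is a linear forest, and if there are two one-terminal
segments then their vertices lie in distinct components of this forest. -/
def IsExtendedSegmentSystem {V : Type*} (G : SimpleGraph V) (T : Set V) {r : ℕ}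
    (P : Fin r → PathIn G) : Prop :=
  (∃ i, IsOneTerminalSegment G T (P i)) ∧
  (∀ i j l : Fin r, IsOneTerminalSegment G T (P i) → IsOneTerminalSegment G T (P j) →
      IsOneTerminalSegment G T (P l) → i = j ∨ i = l ∨ j = l) ∧
  (∀ i, IsOneTerminalSegment G T (P i) ∨ IsTwoTerminalSegment G T (P i)) ∧
  InternallyDisjoint P ∧
  (∀ i, IsOneTerminalSegment G T (P i) → ∀ x : V, (P i).IsEndpoint x → x ∉ T →
      ∀ j, j ≠ i → x ∉ (P j).verts) ∧
  IsLinearForest (segUnionGraph P) ∧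
  (∀ i j : Fin r, i ≠ j → IsOneTerminalSegment G T (P i) → IsOneTerminalSegment G T (P j) →
      ∀ x ∈ (P i).verts, ∀ y ∈ (P j).verts, ¬ (segUnionGraph P).Reachable x y)

/-- The total number of vertices of the paths of the family lying outside `T`. -/
noncomputable def outsideCount {V : Type*} {G : SimpleGraph V} {r : ℕ} (T : Set V)
    (P : Fin r → PathIn G) : ℕ :=
  ((⋃ i, (P i).verts) \ T).ncard

/-- `H` is a `d`-core of `G`: an inclusion-maximal vertex set inducing a connected
subgraph of minimum degree at least `d`. -/
def IsDCore {V : Type*} (G : SimpleGraph V) (d : ℕ) (H : Set V) : Prop :=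
  (G.induce H).Connected ∧
  (∀ v ∈ H, d ≤ (G.neighborSet v ∩ H).ncard) ∧
  ∀ H' : Set V, H ⊆ H' → (G.induce H').Connected →
    (∀ v ∈ H', d ≤ (G.neighborSet v ∩ H').ncard) → H' = H

/-- The sum of `w a b` over the pairs `a, b` of consecutive entries of a list. -/
def pairSum {V : Type*} (w : V → V → ℕ) : List V → ℕ
  | [] => 0
  | [_] => 0
  | a :: b :: l => w a b + pairSum w (b :: l)

section PairSum

variable {V : Type*} {w : V → V → ℕ}

theorem pairSum_append (A B : List V) (x y : V) :
    pairSum w (A ++ x :: y :: B) = pairSum w (A ++ [x]) + w x y + pairSum w (y :: B) := by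
  induction A with
  | nil => simp [pairSum]
  | cons a A ih =>
    cases A with
    | nil => simp [pairSum]; omega
    | cons b A => simp only [List.cons_append, pairSum] at ih ⊢; omega

theorem pairSum_reverse (hw : ∀ a b, w a b = w b a) (l : List V) :
    pairSum w l.reverse = pairSum w l := by
  induction l with
  | nil => rfl
  | cons a l ih =>
    cases l with
    | nil => rfl
    | cons b l =>
      have h := pairSum_append (w := w) l.reverse [] b a
      simp only [List.reverse_cons, List.append_assoc, List.cons_append, List.nil_append,
        pairSum] at ih h ⊢
      rw [h, ih, hw b a]
      omega

theorem pairSum_exchange (hw : ∀ a b, w a b = w b a) (A E D : List V) (x y a b : V) :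
    pairSum w (A ++ x :: a :: (E.reverse ++ y :: b :: D)) + w x y + w a b =
      pairSum w (A ++ x :: y :: (E ++ a :: b :: D)) + w x a + w y b := by
  have h₁ := pairSum_append (w := w) A (E.reverse ++ y :: b :: D) x a
  have h₂ := pairSum_append (w := w) A (E ++ a :: b :: D) x y
  have h₃ := pairSum_append (w := w) (a :: E.reverse) D y b
  have h₄ := pairSum_append (w := w) (y :: E) D a b
  have h₅ := pairSum_reverse hw (y :: (E ++ [a]))
  simp only [List.reverse_cons, List.reverse_append, List.cons_append,
    List.nil_append, List.reverse_nil] at h₁ h₂ h₃ h₄ h₅ ⊢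
  omega

theorem perm_exchange (A E D : List V) (x y a b : V) :
    (A ++ x :: a :: (E.reverse ++ y :: b :: D)).Perm (A ++ x :: y :: (E ++ a :: b :: D)) := by
  classical
  rw [List.perm_iff_count]
  intro z
  simp only [List.count_append, List.count_cons, List.count_reverse]
  omega

theorem pairSum_eq_zero_iff {l : List V} :
    pairSum w l = 0 ↔ l.IsChain (fun a b => w a b = 0) := by
  induction l with
  | nil => simp [pairSum]
  | cons a l ih =>
    cases l with
    | nil => simp [pairSum]
    | cons b l => simp [pairSum, ih]

theorem exists_split_of_pairSum_pos {l : List V} (h : 0 < pairSum w l) :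
    ∃ A x y B, l = A ++ x :: y :: B ∧ 0 < w x y := by
  induction l with
  | nil => simp [pairSum] at h
  | cons a l ih =>
    cases l with
    | nil => simp [pairSum] at h
    | cons b l =>
      by_cases hab : 0 < w a b
      · exact ⟨[], a, b, l, rfl, hab⟩
      · obtain ⟨A, x, y, B, hl, hxy⟩ := ih (by simp only [pairSum] at h; omega)
        exact ⟨a :: A, x, y, B, by simp [hl], hxy⟩

/-- If each pair of consecutive entries has its first entry in `φ` or its second entry in `ψ`,
then the list is short. -/
theorem length_le_countP_add_countP (φ ψ : V → Bool) (l : List V)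
    (h : ∀ A x y B, l = A ++ x :: y :: B → φ x ∨ ψ y) :
    l.length ≤ l.countP φ + l.countP ψ + 1 := by
  suffices ∀ (l : List V) (a : V), (∀ A x y B, a :: l = A ++ x :: y :: B → φ x ∨ ψ y) →
      l.length ≤ (a :: l).countP φ + l.countP ψ by
    cases l with
    | nil => simp
    | cons a l =>
      have := this l a h
      have h' := List.countP_le_length (p := ψ) (l := l)
      simp only [List.length_cons, List.countP_cons (p := ψ)]
      omega
  intro l
  induction l with
  | nil => simp
  | cons b l ih =>
    intro a h
    have h₁ := ih b fun A x y B hl => h (a :: A) x y B (by simp [hl])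
    have h₂ := h [] a b l rfl
    rw [List.countP_cons (p := φ) (a := a), List.countP_cons (p := ψ) (a := b)]
    simp only [List.length_cons]
    rcases h₂ with h₂ | h₂ <;> simp only [h₂, if_true] <;> omega

end PairSum

/-- An Ore-type closure: if all vertices of `H` have at most `m` non-neighbours in a long list of
vertices, then a Hamiltonian path of the graph obtained by making `H` complete can be
turned into a Hamiltonian path of the graph. -/
theorem exists_perm_isChain_adj {V : Type*} (G : SimpleGraph V) (H : Set V) (m : ℕ)
    (L : List V) (hL : L.IsChain fun a b => G.Adj a b ∨ a ∈ H ∧ b ∈ H)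
    (hm : 2 * m + 1 < L.length)
    (hdeg : ∀ v ∈ H, ∀ φ : V → Bool, (∀ x, φ x ↔ ¬ G.Adj v x) → L.countP φ ≤ m) :
    ∃ L' : List V, L'.Perm L ∧ L'.IsChain G.Adj := by
  classical
  let w : V → V → ℕ := fun a b => if G.Adj a b then 0 else 1
  let w' : V → V → ℕ := fun a b => if G.Adj a b ∨ a ∈ H ∧ b ∈ H then 0 else 1
  have hw : ∀ a b, w a b = w b a := fun a b => by simp only [w, G.adj_comm]
  have hw' : ∀ a b, w' a b = w' b a := fun a b => by simp only [w', G.adj_comm, and_comm]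
  have hone : ∀ a b, G.Adj a b → w a b = 0 ∧ w' a b = 0 := fun a b h => by simp [w, w', h]
  have hle : ∀ a b, ¬ G.Adj a b → w a b = 1 := fun a b h => by simp [w, h]
  suffices ∀ n (L₁ : List V), L₁.Perm L → pairSum w' L₁ = 0 → pairSum w L₁ = n →
      ∃ L' : List V, L'.Perm L ∧ L'.IsChain G.Adj from
    this _ L (List.Perm.refl _)
      (pairSum_eq_zero_iff.2 (hL.imp fun a b h => by simp only [w', if_pos h])) rfl
  intro n
  induction n using Nat.strong_induction_on with
  | _ n ih =>
  intro L₁ hperm h₀ hn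
  rcases Nat.eq_zero_or_pos (pairSum w L₁) with hz | hpos
  · refine ⟨L₁, hperm, (pairSum_eq_zero_iff.1 hz).imp fun a b h => ?_⟩
    by_contra hab
    simp [hle a b hab] at h
  obtain ⟨A, x, y, B, hsplit, hxy⟩ := exists_split_of_pairSum_pos hpos
  have hxy : ¬ G.Adj x y := fun h => by simp [(hone x y h).1] at hxy
  have hH : x ∈ H ∧ y ∈ H := by
    by_contra hc
    have := pairSum_append (w := w') A B x y
    rw [← hsplit] at this
    have h1 : w' x y = 1 := by simp [w', hxy, hc]
    omega
  have key : ∃ C a b D, L₁ = C ++ a :: b :: D ∧ G.Adj x a ∧ G.Adj y b := by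
    by_contra hc
    have hc : ∀ C a b D, L₁ = C ++ a :: b :: D → ¬ (G.Adj x a ∧ G.Adj y b) :=
      fun C a b D h h' => hc ⟨C, a, b, D, h, h'⟩
    have h := length_le_countP_add_countP (fun a => decide (¬ G.Adj x a))
      (fun a => decide (¬ G.Adj y a)) L₁ fun C a b D hl => by
        have := hc C a b D hl
        simp only [decide_eq_true_eq]
        tauto
    rw [hperm.countP_eq, hperm.countP_eq, hperm.length_eq] at h
    have h1 := hdeg x hH.1 (fun a => decide (¬ G.Adj x a)) (by simp)
    have h2 := hdeg y hH.2 (fun a => decide (¬ G.Adj y a)) (by simp)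
    omega
  obtain ⟨C, a, b, D, hsplit', hxa, hyb⟩ := key
  have step : ∀ (A E D : List V) (x y a b : V), L₁ = A ++ x :: y :: (E ++ a :: b :: D) →
      G.Adj x a → G.Adj y b → ¬ G.Adj x y ∨ ¬ G.Adj a b →
      ∃ L' : List V, L'.Perm L ∧ L'.IsChain G.Adj := by
    intro A E D x y a b hl hxa hyb hbad
    have e₁ := pairSum_exchange hw A E D x y a b
    have e₂ := pairSum_exchange hw' A E D x y a b
    rw [← hl, (hone _ _ hxa).1, (hone _ _ hyb).1] at e₁
    rw [← hl, (hone _ _ hxa).2, (hone _ _ hyb).2] at e₂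
    refine ih _ ?_ _ ((perm_exchange A E D x y a b).trans (hl ▸ hperm)) (by omega) rfl
    rcases hbad with h | h <;> have := hle _ _ h <;> omega
  rw [hsplit, List.append_eq_append_iff] at hsplit'
  rcases hsplit' with ⟨E, rfl, hE⟩ | ⟨E, rfl, hE⟩
  · rcases E with _ | ⟨e, _ | ⟨f, E⟩⟩
    · simp only [List.nil_append, List.cons.injEq] at hE
      exact absurd (hE.1 ▸ hxa) (G.irrefl)
    · simp only [List.cons_append, List.nil_append, List.cons.injEq] at hE
      exact absurd (hE.2.1 ▸ hxa) hxy
    · simp only [List.cons_append, List.cons.injEq] at hE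
      obtain ⟨rfl, rfl, rfl⟩ := hE
      exact step A E D x y a b hsplit hxa hyb (.inl hxy)
  · rcases E with _ | ⟨e, _ | ⟨f, E⟩⟩
    · simp only [List.nil_append, List.cons.injEq] at hE
      exact absurd (hE.1 ▸ hxa) (G.irrefl)
    · simp only [List.cons_append, List.nil_append, List.cons.injEq] at hE
      exact absurd (hE.2.1 ▸ hyb).symm hxy
    · simp only [List.cons_append, List.cons.injEq] at hE
      obtain ⟨rfl, rfl, rfl⟩ := hE
      exact step C E B a b x y (by simpa using hsplit) hxa.symm hyb.symm (.inr hxy)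

theorem SimpleGraph.Walk.forall_mem_support_of_forall_adj {V : Type*} {F : SimpleGraph V}
    {p : V → Prop} (hp : ∀ v, p v → ∀ w, F.Adj v w → p w) {v w : V} (q : F.Walk v w) (hv : p v) :
    ∀ x ∈ q.support, p x := by
  induction q with
  | nil => simpa using hv
  | cons h q ih =>
    intro x hx
    rcases List.mem_cons.1 (Walk.support_cons h q ▸ hx) with rfl | hx
    · exact hv
    · exact ih (hp _ hv _ h) x hx

section Forest

variable {V : Type*} [Finite V] {F : SimpleGraph V}

theorem exists_isPath_forall_adj_end_mem_support (F : SimpleGraph V) (z : V) :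
    ∃ (e : V) (q : F.Walk z e), q.IsPath ∧ ∀ w, F.Adj e w → w ∈ q.support := by
  classical
  have := Fintype.ofFinite V
  have hne : {n | ∃ (e : V) (q : F.Walk z e), q.IsPath ∧ q.length = n}.Nonempty :=
    ⟨0, z, .nil, .nil, rfl⟩
  have hbdd : BddAbove {n | ∃ (e : V) (q : F.Walk z e), q.IsPath ∧ q.length = n} :=
    ⟨Fintype.card V, by rintro _ ⟨e, q, hq, rfl⟩; exact hq.length_lt.le⟩
  obtain ⟨e, q, hq, hlen⟩ := Nat.sSup_mem hne hbdd
  refine ⟨e, q, hq, fun w hw => ?_⟩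
  by_contra hc
  have := le_csSup hbdd ⟨w, q.concat hw, hq.concat hc hw, rfl⟩
  rw [← hlen, Walk.length_concat] at this
  omega

theorem SimpleGraph.IsAcyclic.ncard_neighborSet_le_one (hF : F.IsAcyclic) {z e : V}
    {q : F.Walk z e} (hq : q.IsPath) (he : ∀ w, F.Adj e w → w ∈ q.support) :
    (F.neighborSet e).ncard ≤ 1 := by
  rw [Set.ncard_le_one (Set.toFinite _)]
  intro a ha b hb
  rw [hF.eq_penultimate_of_adj_end hq ha (he a ha), hF.eq_penultimate_of_adj_end hq hb (he b hb)]

theorem mem_support_of_adj_of_mem_support (hdeg : ∀ v, (F.neighborSet v).ncard ≤ 2) {z e : V}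
    {q : F.Walk z e} (hq : q.IsPath) (hz : (F.neighborSet z).ncard ≤ 1)
    (he : ∀ w, F.Adj e w → w ∈ q.support) {v w : V} (hv : v ∈ q.support) (hvw : F.Adj v w) :
    w ∈ q.support := by
  obtain ⟨i, rfl, hi⟩ := Walk.mem_support_iff_exists_getVert.1 hv
  rcases hi.eq_or_lt with rfl | hlt
  · rw [Walk.getVert_length] at hvw
    exact he w hvw
  suffices h : F.neighborSet (q.getVert i) ⊆ q.toSubgraph.neighborSet (q.getVert i) from
    (q.mem_verts_toSubgraph).1 (q.toSubgraph.edge_vert (h hvw).symm)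
  have hsub : q.toSubgraph.neighborSet (q.getVert i) ⊆ F.neighborSet (q.getVert i) :=
    Subgraph.neighborSet_subset _ _
  refine (Set.eq_of_subset_of_ncard_le hsub ?_ (Set.toFinite _)).ge
  rcases Nat.eq_zero_or_pos i with rfl | hpos
  · have hnil : ¬ q.Nil := by rw [← Walk.length_eq_zero_iff]; omega
    rw [Walk.getVert_zero, hq.neighborSet_toSubgraph_startpoint hnil, Set.ncard_singleton]
    exact hz
  · rw [hq.ncard_neighborSet_toSubgraph_internal_eq_two (by omega) hlt]
    exact hdeg _

/-- The component of a vertex `z` of degree at most one in a linear forest is traversed by a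
path that starts at `z`. -/
theorem IsLinearForest.exists_isPath_of_ncard_le_one (hF : IsLinearForest F) {z : V}
    (hz : (F.neighborSet z).ncard ≤ 1) :
    ∃ (e : V) (q : F.Walk z e), q.IsPath ∧ (F.neighborSet e).ncard ≤ 1 ∧
      ∀ v ∈ q.support, ∀ w, F.Adj v w → w ∈ q.support := by
  obtain ⟨e, q, hq, he⟩ := exists_isPath_forall_adj_end_mem_support F z
  exact ⟨e, q, hq, hF.1.ncard_neighborSet_le_one hq he,
    fun v hv w hvw => mem_support_of_adj_of_mem_support hF.2 hq hz he hv hvw⟩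

/-- A union of components of a linear forest all of whose ends lie in `H` can be arranged in a
list whose consecutive entries are adjacent or lie in `H`. -/
theorem IsLinearForest.exists_isChain (hF : IsLinearForest F) (H : Set V) (X : Finset V)
    (hX : ∀ v ∈ X, ∀ w, F.Adj v w → w ∈ X)
    (hend : ∀ v ∈ X, (F.neighborSet v).ncard ≤ 1 → v ∈ H) :
    ∃ L : List V, L.Nodup ∧ (∀ v, v ∈ L ↔ v ∈ X) ∧
      L.IsChain (fun a b => F.Adj a b ∨ a ∈ H ∧ b ∈ H) ∧
      (∀ v ∈ L.head?, v ∈ H) ∧ ∀ v ∈ L.getLast?, v ∈ H := by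
  classical
  induction hn : X.card using Nat.strong_induction_on generalizing X with
  | _ n ih =>
  rcases X.eq_empty_or_nonempty with rfl | ⟨v, hv⟩
  · exact ⟨[], by simp⟩
  have hreach : ∀ {v w : V} (q : F.Walk v w), v ∈ X → ∀ x ∈ q.support, x ∈ X :=
    fun q => q.forall_mem_support_of_forall_adj (p := (· ∈ X)) hX
  obtain ⟨z, q₀, hq₀, hz⟩ := exists_isPath_forall_adj_end_mem_support F v
  have hzdeg := hF.1.ncard_neighborSet_le_one hq₀ hz
  have hzX : z ∈ X := hreach q₀ hv z q₀.end_mem_support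
  obtain ⟨e, q, hq, he, hcl⟩ := hF.exists_isPath_of_ncard_le_one hzdeg
  have hqX := hreach q hzX
  have heX := hqX e q.end_mem_support
  obtain ⟨L, hnd, hmem, hch, hhd, hlast⟩ := ih (X \ q.support.toFinset).card
    (by
      rw [← hn]
      refine Finset.card_lt_card (Finset.sdiff_ssubset (fun x hx => hqX x (by simpa using hx))
        ⟨z, by simp⟩))
    (X \ q.support.toFinset)
    (fun a ha b hab => by
      simp only [Finset.mem_sdiff, List.mem_toFinset] at ha ⊢
      exact ⟨hX a ha.1 b hab, fun hb => ha.2 (hcl b hb a hab.symm)⟩)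
    (fun a ha => hend a (Finset.mem_sdiff.1 ha).1) rfl
  have hzH := hend z hzX hzdeg
  have heH := hend e heX he
  refine ⟨q.support ++ L, ?_, ?_, ?_, ?_, ?_⟩
  · rw [List.nodup_append']
    refine ⟨hq.support_nodup, hnd, fun x hx hx' => ?_⟩
    have := (hmem x).1 hx'
    simp [hx] at this
  · intro x
    rw [List.mem_append, hmem, Finset.mem_sdiff, List.mem_toFinset]
    have := hqX x
    tauto
  · rw [List.isChain_append]
    refine ⟨q.isChain_adj_support.imp fun a b h => .inl h, hch,
      fun x hx y hy => .inr ⟨?_, hhd y hy⟩⟩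
    rw [List.getLast?_eq_some_getLast q.support_ne_nil, Walk.getLast_support] at hx
    simp only [Option.mem_def, Option.some.injEq] at hx
    exact hx ▸ heH
  · intro x hx
    rw [← Walk.cons_tail_support] at hx
    simp only [List.cons_append, List.head?_cons, Option.mem_def, Option.some.injEq] at hx
    exact hx ▸ hzH
  · intro x hx
    rw [List.getLast?_append] at hx
    rcases h : L.getLast? with _ | y
    · rw [h, List.getLast?_eq_some_getLast q.support_ne_nil, Walk.getLast_support] at hx
      simp only [Option.none_or, Option.mem_def, Option.some.injEq] at hx
      exact hx ▸ heH
    · rw [h] at hx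
      simp only [Option.some_or, Option.mem_def, Option.some.injEq] at hx
      exact hx ▸ hlast y h

end Forest

section Segment

variable {V : Type*} {G : SimpleGraph V} {T : Set V}

theorem SimpleGraph.Walk.IsPath.mem_tail_support_iff {u v x : V} {p : G.Walk u v} (hp : p.IsPath) :
    x ∈ p.support.tail ↔ x ∈ p.support ∧ x ≠ u := by
  have h := hp.support_nodup
  rw [← Walk.cons_tail_support, List.nodup_cons] at h
  rw [Walk.mem_support_iff]
  constructor
  · exact fun hx => ⟨.inr hx, fun hxu => h.1 (hxu ▸ hx)⟩
  · rintro ⟨rfl | hx, hne⟩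
    · exact absurd rfl hne
    · exact hx

theorem SimpleGraph.Walk.IsPath.mem_dropLast_support_iff {u v x : V} {p : G.Walk u v}
    (hp : p.IsPath) : x ∈ p.support.dropLast ↔ x ∈ p.support ∧ x ≠ v := by
  have h := hp.reverse.mem_tail_support_iff (x := x)
  rwa [Walk.support_reverse, List.tail_reverse, List.mem_reverse, List.mem_reverse] at h

theorem SimpleGraph.Walk.IsPath.mem_dropLast_tail_support_iff {u v x : V} {p : G.Walk u v}
    (hp : p.IsPath) (huv : u ≠ v) :
    x ∈ p.support.tail.dropLast ↔ x ∈ p.support ∧ x ≠ u ∧ x ≠ v := by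
  have hl : p.support.dropLast = u :: p.support.tail.dropLast := by
    cases p with
    | nil => exact absurd rfl huv
    | cons h p => simp [List.dropLast_cons_of_ne_nil p.support_ne_nil]
  have h := hp.support_nodup.sublist (List.dropLast_sublist _)
  rw [hl, List.nodup_cons] at h
  have h' := hp.mem_dropLast_support_iff (x := x)
  rw [hl, List.mem_cons] at h'
  constructor
  · intro hx
    exact ⟨(h'.1 (.inr hx)).1, fun hxu => h.1 (hxu ▸ hx), (h'.1 (.inr hx)).2⟩
  · rintro ⟨hx, hu, hv⟩
    exact (h'.2 ⟨hx, hv⟩).resolve_left hu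

namespace PathIn

theorem mem_verts_of_isEndpoint {P : PathIn G} {x : V} (hx : P.IsEndpoint x) : x ∈ P.verts := by
  rcases hx with rfl | rfl
  · exact P.walk.start_mem_support
  · exact P.walk.end_mem_support

theorem first_ne_last_iff {P : PathIn G} : P.first ≠ P.last ↔ 2 ≤ P.walk.support.length := by
  obtain ⟨u, v, p, hp⟩ := P
  rw [Walk.length_support]
  constructor
  · intro h
    have : p.length ≠ 0 := fun h0 => h (Walk.eq_of_length_eq_zero h0)
    change 2 ≤ p.length + 1
    omega
  · rintro h (rfl : u = v)
    have h' := (Walk.isPath_iff_nil.1 hp).eq_nil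
    change 2 ≤ p.length + 1 at h
    rw [h'] at h
    simp at h

theorem ncard_neighborSet_of_isEndpoint {P : PathIn G} (hP : P.first ≠ P.last) {x : V}
    (hx : P.IsEndpoint x) : (P.walk.toSubgraph.neighborSet x).ncard = 1 := by
  have hnil : ¬ P.walk.Nil := fun h => hP h.eq
  rcases hx with rfl | rfl
  · rw [P.isPath.neighborSet_toSubgraph_startpoint hnil, Set.ncard_singleton]
  · rw [P.isPath.neighborSet_toSubgraph_endpoint hnil, Set.ncard_singleton]

theorem ncard_neighborSet_of_not_isEndpoint {P : PathIn G} {x : V} (hx : x ∈ P.verts)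
    (hx' : ¬ P.IsEndpoint x) : (P.walk.toSubgraph.neighborSet x).ncard = 2 := by
  obtain ⟨i, rfl, hi⟩ := Walk.mem_support_iff_exists_getVert.1 hx
  refine P.isPath.ncard_neighborSet_toSubgraph_internal_eq_two ?_ (lt_of_le_of_ne hi ?_)
  · rintro rfl
    exact hx' (.inl P.walk.getVert_zero)
  · rintro rfl
    exact hx' (.inr P.walk.getVert_length)

end PathIn

theorem isOneTerminalSegment_iff {P : PathIn G} :
    IsOneTerminalSegment G T P ↔ P.first ≠ P.last ∧
      ∃ t, P.IsEndpoint t ∧ t ∈ T ∧ ∀ x ∈ P.verts, x ≠ t → x ∉ T := by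
  rw [IsOneTerminalSegment, PathIn.first_ne_last_iff]
  refine and_congr_right fun h => ?_
  simp only [P.isPath.mem_tail_support_iff, P.isPath.mem_dropLast_support_iff, and_imp]
  constructor
  · rintro (⟨h, h'⟩ | ⟨h, h'⟩)
    · exact ⟨_, .inl rfl, h, h'⟩
    · exact ⟨_, .inr rfl, h, h'⟩
  · rintro ⟨t, rfl | rfl, h, h'⟩
    · exact .inl ⟨h, h'⟩
    · exact .inr ⟨h, h'⟩

theorem IsOneTerminalSegment.exists_outer {P : PathIn G} (hP : IsOneTerminalSegment G T P) :
    ∃ z, P.IsEndpoint z ∧ z ∉ T ∧ ∀ x, P.IsEndpoint x → x ∉ T → x = z := by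
  obtain ⟨hne, t, rfl | rfl, ht, h⟩ := isOneTerminalSegment_iff.1 hP
  · refine ⟨_, .inr rfl, h _ P.walk.end_mem_support hne.symm, ?_⟩
    rintro x (rfl | rfl) hx
    · exact absurd ht hx
    · rfl
  · refine ⟨_, .inl rfl, h _ P.walk.start_mem_support hne, ?_⟩
    rintro x (rfl | rfl) hx
    · rfl
    · exact absurd ht hx

variable {r : ℕ} {P : Fin r → PathIn G}

theorem segUnionGraph_adj {x y : V} :
    (segUnionGraph P).Adj x y ↔ ∃ i, (P i).walk.toSubgraph.Adj x y := by
  simp [segUnionGraph]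

theorem segUnionGraph_le : segUnionGraph P ≤ G := Subgraph.spanningCoe_le _

variable [Finite V]

theorem exists_isEndpoint_of_ncard_le_one {x : V} {i : Fin r} (hx : x ∈ (P i).verts)
    (hdeg : ((segUnionGraph P).neighborSet x).ncard ≤ 1) : (P i).IsEndpoint x := by
  by_contra hc
  have h := PathIn.ncard_neighborSet_of_not_isEndpoint hx hc
  have h' := Set.ncard_le_ncard (s := (P i).walk.toSubgraph.neighborSet x)
    (t := (segUnionGraph P).neighborSet x) (fun y hy => segUnionGraph_adj.2 ⟨i, hy⟩)
    (Set.toFinite _)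
  omega

namespace IsExtendedSegmentSystem

omit [Finite V] in
theorem mem_of_adj {v w : V} (h : (segUnionGraph P).Adj v w) : w ∈ ⋃ i, (P i).verts := by
  obtain ⟨i, hi⟩ := segUnionGraph_adj.1 h
  exact Set.mem_iUnion.2 ⟨i, (Walk.mem_verts_toSubgraph _).1 hi.snd_mem⟩

theorem mem_or_isEndpoint_of_ncard_le_one (hP : IsExtendedSegmentSystem G T P) {x : V}
    (hx : x ∈ T ∪ ⋃ i, (P i).verts) (hdeg : ((segUnionGraph P).neighborSet x).ncard ≤ 1) :
    x ∈ T ∨ ∃ i, IsOneTerminalSegment G T (P i) ∧ (P i).IsEndpoint x ∧ x ∉ T := by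
  by_cases hxT : x ∈ T
  · exact .inl hxT
  obtain ⟨i, hi⟩ := Set.mem_iUnion.1 (hx.resolve_left hxT)
  have he := exists_isEndpoint_of_ncard_le_one hi hdeg
  rcases hP.2.2.1 i with h | h
  · exact .inr ⟨i, h, he, hxT⟩
  · rcases he with rfl | rfl
    · exact absurd h.2.1 hxT
    · exact absurd h.2.2.1 hxT

/-- The component of the linear forest that contains a one-terminal segment is a path from the
outer end of the segment to a vertex of `T`. -/
theorem exists_isPath (hP : IsExtendedSegmentSystem G T P) {i : Fin r}
    (hi : IsOneTerminalSegment G T (P i)) :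
    ∃ (z e : V) (q : (segUnionGraph P).Walk z e), q.IsPath ∧ e ∈ T ∧ z ∈ (P i).verts ∧
      (∀ x, (P i).IsEndpoint x → x ∉ T → x = z) ∧
      (∀ x ∈ q.support, x ∈ T ∪ ⋃ i, (P i).verts) ∧
      ∀ v ∈ q.support, ∀ w, (segUnionGraph P).Adj v w → w ∈ q.support := by
  obtain ⟨z, hz, hzT, huniq⟩ := hi.exists_outer
  have hne := (isOneTerminalSegment_iff.1 hi).1
  have hone := PathIn.ncard_neighborSet_of_isEndpoint hne hz
  have hsub : (segUnionGraph P).neighborSet z ⊆ (P i).walk.toSubgraph.neighborSet z := by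
    intro y hy
    obtain ⟨j, hj⟩ := segUnionGraph_adj.1 hy
    by_cases hji : j = i
    · exact hji ▸ hj
    · exact absurd ((Walk.mem_verts_toSubgraph _).1 hj.fst_mem)
        (hP.2.2.2.2.1 i hi z hz hzT j hji)
  have hzX : z ∈ T ∪ ⋃ i, (P i).verts :=
    .inr (Set.mem_iUnion.2 ⟨i, PathIn.mem_verts_of_isEndpoint hz⟩)
  obtain ⟨e, q, hq, he, hcl⟩ := hP.2.2.2.2.2.1.exists_isPath_of_ncard_le_one
    ((Set.ncard_le_ncard hsub (Set.toFinite _)).trans hone.le)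
  have hqX := q.forall_mem_support_of_forall_adj (p := (· ∈ T ∪ ⋃ i, (P i).verts))
    (fun _ _ _ h => .inr (mem_of_adj h)) hzX
  refine ⟨z, e, q, hq, ?_, PathIn.mem_verts_of_isEndpoint hz, huniq, hqX, hcl⟩
  refine (hP.mem_or_isEndpoint_of_ncard_le_one (hqX e q.end_mem_support) he).resolve_right ?_
  rintro ⟨j, hj, hje, heT⟩
  by_cases hji : i = j
  · subst hji
    obtain rfl := huniq e hje heT
    obtain ⟨y, hy⟩ := Set.ncard_eq_one.1 hone
    have hyadj : (P i).walk.toSubgraph.Adj e y := by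
      rw [← Subgraph.mem_neighborSet, hy]; rfl
    have := hcl e q.start_mem_support y (segUnionGraph_adj.2 ⟨i, hyadj⟩)
    rw [(Walk.isPath_iff_nil.1 hq).eq_nil] at this
    simp only [Walk.support_nil, List.mem_singleton] at this
    exact hyadj.adj_sub.ne this.symm
  · exact hP.2.2.2.2.2.2 i j hji hi hj z (PathIn.mem_verts_of_isEndpoint hz) e
      (PathIn.mem_verts_of_isEndpoint hje) ⟨q⟩

/-- The components of the union of an extended system and the vertices of `T` can be arranged in a
list whose consecutive entries are adjacent or lie in `T`. -/
theorem exists_isChain (hP : IsExtendedSegmentSystem G T P) :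
    ∃ L : List V, L.Nodup ∧ (∀ v, v ∈ L ↔ v ∈ T ∪ ⋃ i, (P i).verts) ∧
      L.IsChain fun a b => G.Adj a b ∨ a ∈ T ∧ b ∈ T := by
  classical
  obtain ⟨i, hi⟩ := hP.1
  obtain ⟨z, e, q, hq, he, hz, huniq, hqX, hcl⟩ := hP.exists_isPath hi
  obtain ⟨M, hMnd, hMch, hMhd, hMX, hMcl, hMq, hMend⟩ : ∃ M : List V, M.Nodup ∧
      M.IsChain (segUnionGraph P).Adj ∧ (∀ v ∈ M.head?, v ∈ T) ∧
      (∀ v ∈ M, v ∈ T ∪ ⋃ i, (P i).verts) ∧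
      (∀ v ∈ M, ∀ w, (segUnionGraph P).Adj v w → w ∈ M) ∧ (∀ v ∈ q.support, v ∉ M) ∧
      ∀ j, j ≠ i → IsOneTerminalSegment G T (P j) → ∀ x, (P j).IsEndpoint x → x ∉ T → x ∈ M := by
    by_cases hj : ∃ j, j ≠ i ∧ IsOneTerminalSegment G T (P j)
    · obtain ⟨j, hji, hj⟩ := hj
      obtain ⟨z', e', q', hq', he', hz', huniq', hqX', hcl'⟩ := hP.exists_isPath hj
      refine ⟨q'.reverse.support, hq'.reverse.support_nodup, q'.reverse.isChain_adj_support,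
        ?_, ?_, ?_, ?_, ?_⟩
      · intro v hv
        rw [← Walk.cons_tail_support, List.head?_cons, Option.mem_def, Option.some.injEq] at hv
        exact hv ▸ he'
      · simpa using hqX'
      · simpa using hcl'
      · intro v hv hv'
        rw [Walk.support_reverse, List.mem_reverse] at hv'
        exact hP.2.2.2.2.2.2 i j hji.symm hi hj z hz z' hz'
          ((q.takeUntil v hv).reachable.trans (q'.takeUntil v hv').reachable.symm)
      · intro l hli hl x hx hxT
        rcases hP.2.1 i j l hi hj hl with h | h | h
        · exact absurd h.symm hji
        · exact absurd h.symm hli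
        · subst h
          rw [huniq' x hx hxT]
          simp
    · refine ⟨[], by simp, by simp, by simp, by simp, by simp, by simp, ?_⟩
      intro j hji hj'
      exact absurd ⟨j, hji, hj'⟩ hj
  have := Fintype.ofFinite V
  obtain ⟨L, hnd, hmem, hch, hhd, hlast⟩ := hP.2.2.2.2.2.1.exists_isChain T
    ((T ∪ ⋃ i, (P i).verts).toFinset \ (q.support ++ M).toFinset)
    (fun a ha b hab => by
      simp only [Finset.mem_sdiff, List.mem_toFinset, Set.mem_toFinset, List.mem_append] at ha ⊢
      exact ⟨.inr (mem_of_adj hab),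
        fun hb => ha.2 (hb.imp (fun hb => hcl b hb a hab.symm) fun hb => hMcl b hb a hab.symm)⟩)
    (fun a ha hdeg => by
      simp only [Finset.mem_sdiff, List.mem_toFinset, Set.mem_toFinset, List.mem_append] at ha
      refine (hP.mem_or_isEndpoint_of_ncard_le_one ha.1 hdeg).resolve_right ?_
      rintro ⟨j, hj, hje, haT⟩
      by_cases hji : j = i
      · subst hji
        exact ha.2 (.inl (huniq a hje haT ▸ q.start_mem_support))
      · exact ha.2 (.inr (hMend j hji hj a hje haT)))
  have hmem' : ∀ v, v ∈ L ↔ v ∈ T ∪ ⋃ i, (P i).verts ∧ v ∉ q.support ∧ v ∉ M := by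
    intro v
    rw [hmem, Finset.mem_sdiff, Set.mem_toFinset, List.mem_toFinset, List.mem_append, not_or]
  have hR : ∀ a b, (segUnionGraph P).Adj a b → G.Adj a b ∨ a ∈ T ∧ b ∈ T :=
    fun a b h => .inl (segUnionGraph_le h)
  have hqlast : ∀ x ∈ q.support.getLast?, x ∈ T := by
    intro x hx
    rw [List.getLast?_eq_some_getLast q.support_ne_nil, Walk.getLast_support] at hx
    simp only [Option.mem_def, Option.some.injEq] at hx
    exact hx ▸ he
  refine ⟨q.support ++ (L ++ M), ?_, ?_, ?_⟩
  · rw [List.nodup_append', List.nodup_append']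
    refine ⟨hq.support_nodup, ⟨hnd, hMnd, fun x hx => ((hmem' x).1 hx).2.2⟩, fun x hx hx' => ?_⟩
    rcases List.mem_append.1 hx' with h | h
    · exact ((hmem' x).1 h).2.1 hx
    · exact hMq x hx h
  · intro v
    rw [List.mem_append, List.mem_append, hmem']
    have h₁ := hqX v
    have h₂ := hMX v
    generalize (v ∈ T ∪ ⋃ i, (P i).verts) = A at h₁ h₂ ⊢
    tauto
  · rw [List.isChain_append, List.isChain_append]
    refine ⟨q.isChain_adj_support.imp hR,
      ⟨hch.imp fun a b h => h.elim (hR a b) .inr, hMch.imp hR, ?_⟩, ?_⟩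
    · exact fun x hx y hy => .inr ⟨hlast x hx, hMhd y hy⟩
    · intro x hx y hy
      refine .inr ⟨hqlast x hx, ?_⟩
      rw [List.head?_append] at hy
      rcases h : L.head? with _ | a
      · rw [h, Option.none_or] at hy
        exact hMhd y hy
      · rw [h, Option.some_or, Option.mem_def, Option.some.injEq] at hy
        exact hy ▸ hhd a h

end IsExtendedSegmentSystem

end Segment

theorem IsExtendedSegmentSystem.exists_isPath_length {V : Type*} [Finite V] {G : SimpleGraph V}
    {H : Set V} {d k r : ℕ} {P : Fin r → PathIn G} (hP : IsExtendedSegmentSystem G H P)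
    (hdk : k + 1 < d) (hdeg : ∀ v ∈ H, d ≤ (G.neighborSet v ∩ H).ncard)
    (hcount : H.ncard + outsideCount H P = d + k) :
    ∃ (u v : V) (q : G.Walk u v), q.IsPath ∧ d + k ≤ q.support.length := by
  classical
  obtain ⟨L, hnd, hmem, hch⟩ := hP.exists_isChain
  have hlen : L.length = d + k := by
    rw [← List.toFinset_card_of_nodup hnd, ← Set.ncard_coe_finset, ← hcount, outsideCount]
    rw [add_comm, ← Set.ncard_union_eq Set.disjoint_sdiff_left (Set.toFinite _) (Set.toFinite _)]
    congr 1
    ext v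
    simp only [List.coe_toFinset, Set.mem_ofPred_eq, hmem, Set.mem_union, Set.mem_sdiff]
    tauto
  obtain ⟨L', hperm, hch'⟩ := exists_perm_isChain_adj G H k L hch (by omega) (by
    intro v hv φ hφ
    have h₁ : (G.neighborSet v ∩ H).ncard ≤ L.countP (fun x => ! φ x) := by
      rw [List.countP_eq_length_filter]
      refine le_trans ?_ (List.toFinset_card_le _)
      rw [← Set.ncard_coe_finset]
      refine Set.ncard_le_ncard (fun x hx => ?_) (Set.toFinite _)
      have : ¬ φ x = true := fun h => (hφ x).1 h hx.1
      simpa [(hmem x).2 (.inl hx.2)] using this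
    have h₂ := List.length_eq_countP_add_countP φ (l := L)
    have h₃ : L.countP (fun x => ! φ x) = L.countP (fun a => decide (¬ φ a = true)) :=
      List.countP_congr (by simp)
    have := hdeg v hv
    omega)
  have hne : L' ≠ [] := by
    rintro rfl
    have := hperm.length_eq
    simp at this
    omega
  refine ⟨_, _, Walk.ofSupport L' hne hch', Walk.IsPath.mk' ?_, ?_⟩
  · rw [Walk.support_ofSupport]
    exact hperm.nodup_iff.2 hnd
  · rw [Walk.support_ofSupport, hperm.length_eq, hlen]

section PathInterval

variable {V : Type*} {G : SimpleGraph V} {u v : V} {q : G.Walk u v}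

theorem SimpleGraph.Walk.IsPath.getVert_eq_iff (hq : q.IsPath) {i j : ℕ} (hi : i ≤ q.length)
    (hj : j ≤ q.length) : q.getVert i = q.getVert j ↔ i = j :=
  ⟨fun h => hq.getVert_injOn hi hj h, fun h => h ▸ rfl⟩

theorem SimpleGraph.Walk.mem_support_take_iff {n : ℕ} (hn : n ≤ q.length) {x : V} :
    x ∈ (q.take n).support ↔ ∃ i, i ≤ n ∧ q.getVert i = x := by
  rw [Walk.mem_support_iff_exists_getVert]
  simp only [Walk.take_getVert, Walk.take_length]
  constructor
  · rintro ⟨i, h, -⟩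
    exact ⟨_, inf_le_left, h⟩
  · rintro ⟨i, hi, h⟩
    exact ⟨i, by rwa [inf_eq_right.2 hi], by omega⟩

theorem SimpleGraph.Walk.mem_support_drop_iff {n : ℕ} (hn : n ≤ q.length) {x : V} :
    x ∈ (q.drop n).support ↔ ∃ i, n ≤ i ∧ i ≤ q.length ∧ q.getVert i = x := by
  rw [Walk.mem_support_iff_exists_getVert]
  simp only [Walk.drop_getVert, Walk.drop_length]
  constructor
  · rintro ⟨i, h, hi⟩
    exact ⟨_, by omega, by omega, h⟩
  · rintro ⟨i, hi, hi', h⟩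
    exact ⟨i - n, by rwa [Nat.add_sub_cancel' hi], by omega⟩

/-- The part of a path between its `a`-th and its `b`-th vertex. -/
def PathIn.interval (hq : q.IsPath) (a b : ℕ) : PathIn G :=
  ⟨_, _, (q.drop a).take (b - a), (hq.drop a).take _⟩

namespace PathIn

variable (hq : q.IsPath) {a b : ℕ}

theorem interval_first : (interval hq a b).first = q.getVert a := rfl

theorem interval_last (hab : a ≤ b) : (interval hq a b).last = q.getVert b := by
  change (q.drop a).getVert (b - a) = _
  rw [Walk.drop_getVert, Nat.add_sub_cancel' hab]

theorem mem_verts_interval (hab : a ≤ b) (hb : b ≤ q.length) {x : V} :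
    x ∈ (interval hq a b).verts ↔ ∃ i, a ≤ i ∧ i ≤ b ∧ q.getVert i = x := by
  change x ∈ ((q.drop a).take (b - a)).support ↔ _
  rw [Walk.mem_support_take_iff (by rw [Walk.drop_length]; omega)]
  simp only [Walk.drop_getVert]
  constructor
  · rintro ⟨i, hi, h⟩
    exact ⟨_, by omega, by omega, h⟩
  · rintro ⟨i, hi, hi', h⟩
    exact ⟨i - a, by omega, by rwa [Nat.add_sub_cancel' hi]⟩

theorem interval_isEndpoint_iff (hab : a ≤ b) {x : V} :
    (interval hq a b).IsEndpoint x ↔ x = q.getVert a ∨ x = q.getVert b := by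
  rw [IsEndpoint, interval_first, interval_last hq hab]

theorem interval_adj_iff (hab : a ≤ b) (hb : b ≤ q.length) {x y : V} :
    (interval hq a b).walk.toSubgraph.Adj x y ↔
      ∃ i, a ≤ i ∧ i < b ∧ s(q.getVert i, q.getVert (i + 1)) = s(x, y) := by
  change ((q.drop a).take (b - a)).toSubgraph.Adj x y ↔ _
  rw [Walk.toSubgraph_adj_iff]
  simp only [Walk.take_getVert, Walk.drop_getVert, Walk.take_length, Walk.drop_length]
  constructor
  · rintro ⟨i, h, hi⟩
    refine ⟨a + i, by omega, by omega, ?_⟩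
    rwa [inf_eq_right.2 (by omega), inf_eq_right.2 (by omega)] at h
  · rintro ⟨i, hi, hi', h⟩
    refine ⟨i - a, ?_, by omega⟩
    rwa [inf_eq_right.2 (by omega), inf_eq_right.2 (by omega), Nat.add_sub_cancel' hi,
      show a + (i - a + 1) = i + 1 by omega]

end PathIn

theorem SimpleGraph.Walk.IsPath.not_reachable_of_not_adj (hq : q.IsPath) {F : SimpleGraph V} {c : ℕ}
    (hF : ∀ x y, F.Adj x y →
      ∃ i, i < q.length ∧ i ≠ c ∧ s(q.getVert i, q.getVert (i + 1)) = s(x, y))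
    {i j : ℕ} (hi : i ≤ c) (hj : c < j) (hj' : j ≤ q.length) :
    ¬ F.Reachable (q.getVert i) (q.getVert j) := by
  rintro ⟨w⟩
  have hcl : ∀ x, (∃ m, m ≤ c ∧ q.getVert m = x) → ∀ y, F.Adj x y →
      ∃ m, m ≤ c ∧ q.getVert m = y := by
    rintro x ⟨m, hm, rfl⟩ y hxy
    obtain ⟨l, hl, hlc, h⟩ := hF _ _ hxy
    rw [Sym2.eq_iff] at h
    rcases h with ⟨h, rfl⟩ | ⟨rfl, h⟩
    · have := (hq.getVert_eq_iff hl.le (by omega)).1 h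
      exact ⟨l + 1, by omega, rfl⟩
    · have := (hq.getVert_eq_iff hl (by omega)).1 h
      exact ⟨l, by omega, rfl⟩
  obtain ⟨m, hm, h⟩ := w.forall_mem_support_of_forall_adj hcl ⟨i, hi, rfl⟩ _ w.end_mem_support
  have := (hq.getVert_eq_iff (by omega) hj').1 h
  omega

theorem SimpleGraph.Walk.IsPath.isLinearForest [Finite V] (hq : q.IsPath) :
    IsLinearForest q.toSubgraph.spanningCoe := by
  constructor
  · rw [isAcyclic_iff_forall_adj_isBridge]
    have key : ∀ i, i < q.length → ¬ (q.toSubgraph.spanningCoe.deleteEdges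
        {s(q.getVert i, q.getVert (i + 1))}).Reachable (q.getVert i) (q.getVert (i + 1)) := by
      intro i hi
      refine hq.not_reachable_of_not_adj (c := i) (fun a b hab => ?_) le_rfl (Nat.lt_succ_self i) hi
      rw [deleteEdges_adj, Subgraph.spanningCoe_adj, Walk.toSubgraph_adj_iff] at hab
      obtain ⟨⟨j, hj, hjl⟩, hne⟩ := hab
      refine ⟨j, hjl, ?_, hj⟩
      rintro rfl
      exact hne hj.symm
    intro x y hxy
    rw [Subgraph.spanningCoe_adj, Walk.toSubgraph_adj_iff] at hxy
    obtain ⟨i, h, hi⟩ := hxy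
    rw [← h, isBridge_iff]
    exact key i hi
  · intro x
    change (q.toSubgraph.neighborSet x).ncard ≤ 2
    by_cases hx : x ∈ q.support
    · obtain ⟨i, rfl, hi⟩ := Walk.mem_support_iff_exists_getVert.1 hx
      have hsub : q.toSubgraph.neighborSet (q.getVert i) ⊆
          {q.getVert (i - 1), q.getVert (i + 1)} := by
        intro y hy
        obtain ⟨j, h, hj⟩ := q.toSubgraph_adj_iff.1 hy
        rw [Sym2.eq_iff] at h
        rcases h with ⟨h, rfl⟩ | ⟨rfl, h⟩
        · rw [(hq.getVert_eq_iff hj.le hi).1 h]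
          simp
        · rw [← (hq.getVert_eq_iff hj hi).1 h]
          simp
      exact (Set.ncard_le_ncard hsub (Set.toFinite _)).trans
        ((Set.ncard_insert_le _ _).trans (by simp))
    · have : q.toSubgraph.neighborSet x = ∅ := by
        refine Set.eq_empty_of_forall_notMem fun y hy => hx ?_
        exact q.mem_verts_toSubgraph.1 (q.toSubgraph.edge_vert hy)
      simp [this]

theorem IsLinearForest.anti {V : Type*} [Finite V] {F F' : SimpleGraph V} (hF : IsLinearForest F)
    (h : F' ≤ F) : IsLinearForest F' :=
  ⟨hF.1.anti h, fun v => (Set.ncard_le_ncard (fun _ hx => h hx) (Set.toFinite _)).trans (hF.2 v)⟩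

/-- The interval `[a, b]` of positions of a walk is a maximal one whose interior avoids `T`, and it
does not consist of two consecutive positions in `T`. -/
structure IsSegmentInterval (q : G.Walk u v) (T : Set V) (a b : ℕ) : Prop where
  lt : a < b
  le : b ≤ q.length
  notMem : ∀ i, a < i → i < b → q.getVert i ∉ T
  left : q.getVert a ∈ T ∨ a = 0
  right : q.getVert b ∈ T ∨ b = q.length
  not_succ : q.getVert a ∈ T → q.getVert b ∈ T → b ≠ a + 1

namespace IsSegmentInterval

variable {T : Set V} {a b a' b' : ℕ}

theorem left_eq (h : IsSegmentInterval q T a b) (h' : IsSegmentInterval q T a' b')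
    {i : ℕ} (hi : a < i) (hib : i ≤ b) (hi' : a' < i) (hib' : i ≤ b') : a = a' := by
  have h₁ := h.notMem a'
  have h₂ := h'.notMem a
  have h₃ := h.left
  have h₄ := h'.left
  rcases lt_trichotomy a a' with hlt | rfl | hlt
  · have := h₁ hlt (by omega)
    have := h₄.resolve_left this
    omega
  · rfl
  · have := h₂ hlt (by omega)
    have := h₃.resolve_left this
    omega

theorem right_eq (h : IsSegmentInterval q T a b) (h' : IsSegmentInterval q T a' b')
    {i : ℕ} (hi : a ≤ i) (hib : i < b) (hi' : a' ≤ i) (hib' : i < b') : b = b' := by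
  have h₁ := h.notMem b'
  have h₂ := h'.notMem b
  have h₃ := h.right
  have h₄ := h'.right
  have h₅ := h.le
  have h₆ := h'.le
  rcases lt_trichotomy b b' with hlt | rfl | hlt
  · have := h₂ (by omega) hlt
    have := h₃.resolve_left this
    omega
  · rfl
  · have := h₁ (by omega) hlt
    have := h₄.resolve_left this
    omega

theorem eq_of_interior (h : IsSegmentInterval q T a b) (h' : IsSegmentInterval q T a' b')
    {i : ℕ} (hi : a < i) (hib : i < b) (hi' : a' ≤ i) (hib' : i ≤ b') : a = a' ∧ b = b' := by
  have hT := h.notMem i hi hib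
  have hle := h.le
  have h₁ : a' ≠ i := by
    rintro rfl
    have := h'.left.resolve_left hT
    omega
  have h₂ : b' ≠ i := by
    rintro rfl
    have := h'.right.resolve_left hT
    omega
  exact ⟨h.left_eq h' hi hib.le (by omega) hib', h.right_eq h' hi.le hib hi' (by omega)⟩

theorem eq_zero_or_eq_length_of_isOneTerminalSegment (hq : q.IsPath)
    (h : IsSegmentInterval q T a b)
    (hone : IsOneTerminalSegment G T (PathIn.interval hq a b)) :
    (a = 0 ∧ q.getVert 0 ∉ T) ∨ b = q.length := by
  obtain ⟨hne, t, ht, htT, hT⟩ := isOneTerminalSegment_iff.1 hone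
  rw [PathIn.interval_first, PathIn.interval_last hq h.lt.le] at hne
  rw [PathIn.interval_isEndpoint_iff hq h.lt.le] at ht
  have hmem := fun x => PathIn.mem_verts_interval hq h.lt.le h.le (x := x)
  rcases ht with rfl | rfl
  · exact .inr (h.right.resolve_left
      (hT _ ((hmem _).2 ⟨b, h.lt.le, le_rfl, rfl⟩) hne.symm))
  · have := hT _ ((hmem _).2 ⟨a, le_rfl, h.lt.le, rfl⟩) hne
    have ha := h.left.resolve_left this
    subst ha
    exact .inl ⟨rfl, this⟩

theorem isOneTerminalSegment (hq : q.IsPath) (h : IsSegmentInterval q T a b)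
    (hT : q.getVert a ∈ T ∧ q.getVert b ∉ T ∨ q.getVert a ∉ T ∧ q.getVert b ∈ T) :
    IsOneTerminalSegment G T (PathIn.interval hq a b) := by
  have hab := h.lt
  have hb := h.le
  have hmem := fun x => PathIn.mem_verts_interval hq h.lt.le h.le (x := x)
  rw [isOneTerminalSegment_iff]
  refine ⟨?_, ?_⟩
  · rw [PathIn.interval_first, PathIn.interval_last hq h.lt.le, Ne,
      hq.getVert_eq_iff (by omega) (by omega)]
    omega
  rcases hT with ⟨ha, hb⟩ | ⟨ha, hb⟩
  · refine ⟨_, (PathIn.interval_isEndpoint_iff hq h.lt.le).2 (.inl rfl), ha, fun x hx hxa => ?_⟩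
    obtain ⟨i, hi, hib, rfl⟩ := (hmem x).1 hx
    rcases hib.eq_or_lt with rfl | hib
    · exact hb
    · exact h.notMem i (lt_of_le_of_ne hi fun h => hxa (h ▸ rfl)) hib
  · refine ⟨_, (PathIn.interval_isEndpoint_iff hq h.lt.le).2 (.inr rfl), hb, fun x hx hxb => ?_⟩
    obtain ⟨i, hi, hib, rfl⟩ := (hmem x).1 hx
    rcases hi.eq_or_lt with rfl | hi
    · exact ha
    · exact h.notMem i hi (lt_of_le_of_ne hib fun h => hxb (h ▸ rfl))

theorem isTwoTerminalSegment (hq : q.IsPath) (h : IsSegmentInterval q T a b)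
    (ha : q.getVert a ∈ T) (hb : q.getVert b ∈ T) :
    IsTwoTerminalSegment G T (PathIn.interval hq a b) := by
  have hab := h.lt
  have hbl := h.le
  have hns := h.not_succ ha hb
  have hmem := fun x => PathIn.mem_verts_interval hq h.lt.le h.le (x := x)
  have hlast := PathIn.interval_last hq h.lt.le
  have hne : (PathIn.interval hq a b).first ≠ (PathIn.interval hq a b).last := by
    rw [PathIn.interval_first, hlast, Ne, hq.getVert_eq_iff (by omega) (by omega)]
    omega
  refine ⟨?_, ha, hlast ▸ hb, fun x hx => ?_⟩
  · change 3 ≤ ((q.drop a).take (b - a)).support.length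
    rw [Walk.length_support, Walk.take_length, Walk.drop_length]
    omega
  · have hx' := ((PathIn.interval hq a b).isPath.mem_dropLast_tail_support_iff hne).1 hx
    obtain ⟨hx', hxa, hxb⟩ := hx'
    rw [PathIn.interval_first] at hxa
    rw [hlast] at hxb
    obtain ⟨i, hi, hib, rfl⟩ := (hmem x).1 hx'
    exact h.notMem i (lt_of_le_of_ne hi fun h => hxa (h ▸ rfl))
      (lt_of_le_of_ne hib fun h => hxb (h ▸ rfl))

theorem exists_of_notMem (hq : 0 < q.length) {i : ℕ} (hi : i ≤ q.length)
    (hiT : q.getVert i ∉ T) : ∃ a b, a ≤ i ∧ i ≤ b ∧ IsSegmentInterval q T a b := by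
  classical
  have ha : ∃ j, j ≤ i ∧ (q.getVert j ∈ T ∨ j = 0) := ⟨0, by omega, .inr rfl⟩
  have hb : ∃ j, i ≤ j ∧ (q.getVert j ∈ T ∨ j = q.length) := ⟨q.length, hi, .inr rfl⟩
  obtain ⟨a, ⟨hai, haT⟩, hamax⟩ : ∃ a, (a ≤ i ∧ (q.getVert a ∈ T ∨ a = 0)) ∧
      ∀ j, a < j → j ≤ i → ¬ (q.getVert j ∈ T ∨ j = 0) := by
    obtain ⟨j, hj, h⟩ := ha
    refine ⟨Nat.findGreatest (fun j => q.getVert j ∈ T ∨ j = 0) i,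
      ⟨Nat.findGreatest_le _, Nat.findGreatest_spec (P := fun j => q.getVert j ∈ T ∨ j = 0) hj h⟩,
      fun j hj hji => Nat.findGreatest_is_greatest hj hji⟩
  have hbmin := fun j => Nat.find_min hb (m := j)
  obtain ⟨hbi, hbT⟩ := Nat.find_spec hb
  have hble : Nat.find hb ≤ q.length := Nat.find_min' hb ⟨hi, .inr rfl⟩
  refine ⟨a, Nat.find hb, hai, hbi, ?_, hble, ?_, haT, hbT, ?_⟩
  · by_contra hlt
    have h₁ : a = i := by omega
    have h₂ : Nat.find hb = i := by omega
    rw [h₁] at haT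
    rw [h₂] at hbT
    have := haT.resolve_left hiT
    have := hbT.resolve_left hiT
    omega
  · intro j haj hjb hjT
    rcases le_or_gt j i with hji | hji
    · exact hamax j haj hji (.inl hjT)
    · exact hbmin j hjb ⟨hji.le, .inl hjT⟩
  · intro haT' hbT' heq
    rcases hai.eq_or_lt with rfl | hlt
    · exact hiT haT'
    · have : Nat.find hb = i := by omega
      exact hiT (this ▸ hbT')

end IsSegmentInterval

theorem exists_enumeration_isSegmentInterval (q : G.Walk u v) (T : Set V) :
    ∃ (r : ℕ) (a b : Fin r → ℕ), (∀ i, IsSegmentInterval q T (a i) (b i)) ∧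
      (∀ i j, a i = a j → b i = b j → i = j) ∧
      ∀ m n, IsSegmentInterval q T m n → ∃ i, a i = m ∧ b i = n := by
  have hfin : {x : ℕ × ℕ | IsSegmentInterval q T x.1 x.2}.Finite := by
    refine ((Set.finite_Iic q.length).prod (Set.finite_Iic q.length)).subset fun x hx => ?_
    exact ⟨hx.lt.le.trans hx.le, hx.le⟩
  have := hfin.to_subtype
  obtain ⟨r, ⟨e⟩⟩ := Finite.exists_equiv_fin {x : ℕ × ℕ | IsSegmentInterval q T x.1 x.2}
  refine ⟨r, fun i => (e.symm i).1.1, fun i => (e.symm i).1.2, fun i => (e.symm i).2,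
    fun i j h h' => e.symm.injective (Subtype.ext (Prod.ext h h')), fun m n h => ?_⟩
  exact ⟨e ⟨(m, n), h⟩, by simp, by simp⟩

theorem SimpleGraph.Walk.IsPath.exists_isExtendedSegmentSystem [Finite V] (hq : q.IsPath)
    {T : Set V} (hlast : v ∉ T) (hne : ∃ i ≤ q.length, q.getVert i ∈ T)
    (hstart : u ∈ T ∨ ∃ c < q.length, q.getVert c ∈ T ∧ q.getVert (c + 1) ∈ T) :
    ∃ (r : ℕ) (P : Fin r → PathIn G), IsExtendedSegmentSystem G T P ∧
      outsideCount T P = ({x | x ∈ q.support} \ T).ncard := by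
  have hN : q.getVert q.length ∉ T := by rwa [q.getVert_length]
  have hpos : 0 < q.length := by
    obtain ⟨i, hi, hiT⟩ := hne
    rcases Nat.eq_zero_or_pos q.length with h0 | h0
    · have : i = q.length := by omega
      exact (hN (this ▸ hiT)).elim
    · exact h0
  obtain ⟨r, a, b, hS, hinj, hsurj⟩ := exists_enumeration_isSegmentInterval q T
  have hmem := fun i x => PathIn.mem_verts_interval hq (hS i).lt.le (hS i).le (x := x)
  have hend := fun i x => PathIn.interval_isEndpoint_iff hq (hS i).lt.le (x := x)
  have hone' := fun i => (hS i).eq_zero_or_eq_length_of_isOneTerminalSegment hq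
  have hpt : ∀ {m n}, m ≤ q.length → n ≤ q.length → q.getVert m = q.getVert n → m = n :=
    fun hm hn h => (hq.getVert_eq_iff hm hn).1 h
  have huniq0 : ∀ i j, a i = 0 → a j = 0 → i = j := by
    intro i j hi hj
    have h₁ := (hS i).lt
    have h₂ := (hS j).lt
    exact hinj i j (hi.trans hj.symm)
      ((hS i).right_eq (hS j) (i := 0) (by omega) (by omega) (by omega) (by omega))
  have huniqN : ∀ i j, b i = q.length → b j = q.length → i = j := by
    intro i j hi hj
    have h₁ := (hS i).lt
    have h₂ := (hS j).lt
    exact hinj i j ((hS i).left_eq (hS j) (i := q.length) (by omega) (by omega) (by omega)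
      (by omega)) (hi.trans hj.symm)
  have hboth : ∀ i, q.getVert (a i) ∈ T ∨ q.getVert (b i) ∈ T := by
    intro i
    by_contra! h
    have ha := (hS i).left.resolve_left h.1
    have hb := (hS i).right.resolve_left h.2
    obtain ⟨m, hm, hmT⟩ := hne
    rcases Nat.eq_zero_or_pos m with rfl | h0
    · exact h.1 (ha ▸ hmT)
    · rcases hm.eq_or_lt with rfl | hlt
      · exact hN hmT
      · exact (hS i).notMem m (by omega) (by omega) hmT
  have hdisj : ∀ i j, i ≠ j → ∀ x, x ∈ (PathIn.interval hq (a i) (b i)).verts →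
      x ∈ (PathIn.interval hq (a j) (b j)).verts →
      (PathIn.interval hq (a i) (b i)).IsEndpoint x := by
    intro i j hij x hxi hxj
    obtain ⟨m, hm, hm', rfl⟩ := (hmem i x).1 hxi
    obtain ⟨n, hn, hn', h⟩ := (hmem j _).1 hxj
    have hli := (hS i).le
    have hlj := (hS j).le
    obtain rfl := hpt (by omega) (by omega) h
    rw [hend]
    by_contra! hcon
    have h₁ : a i ≠ n := fun h => hcon.1 (h ▸ rfl)
    have h₂ : b i ≠ n := fun h => hcon.2 (h ▸ rfl)
    obtain ⟨h₃, h₄⟩ := (hS i).eq_of_interior (hS j) (i := n) (by omega) (by omega) hn hn'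
    exact hij (hinj i j h₃ h₄)
  have hadj : ∀ x y, (segUnionGraph fun i => PathIn.interval hq (a i) (b i)).Adj x y →
      ∃ i m, a i ≤ m ∧ m < b i ∧ s(q.getVert m, q.getVert (m + 1)) = s(x, y) := by
    intro x y hxy
    obtain ⟨i, hi⟩ := segUnionGraph_adj.1 hxy
    obtain ⟨m, h⟩ := (PathIn.interval_adj_iff hq (hS i).lt.le (hS i).le).1 hi
    exact ⟨i, m, h⟩
  have hsep : ∀ i j, a i = 0 → q.getVert 0 ∉ T → b j = q.length → i ≠ j →
      ∀ x ∈ (PathIn.interval hq (a i) (b i)).verts,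
      ∀ y ∈ (PathIn.interval hq (a j) (b j)).verts,
      ¬ (segUnionGraph fun i => PathIn.interval hq (a i) (b i)).Reachable x y := by
    intro i j hi h0 hj hij x hx y hy
    rw [q.getVert_zero] at h0
    obtain ⟨c, hc, hcT, hcT'⟩ := hstart.resolve_left h0
    obtain ⟨m, hm, hm', rfl⟩ := (hmem i x).1 hx
    obtain ⟨n, hn, hn', rfl⟩ := (hmem j _).1 hy
    have h₁ : b i ≤ c := by
      by_contra! hlt
      refine (hS i).notMem c ?_ hlt hcT
      rcases Nat.eq_zero_or_pos c with rfl | h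
      · rw [q.getVert_zero] at hcT
        exact (h0 hcT).elim
      · omega
    have h₂ : c + 1 ≤ a j := by
      by_contra! hlt
      refine (hS j).notMem (c + 1) hlt ?_ hcT'
      have : c + 1 ≠ q.length := fun h => hN (h ▸ hcT')
      omega
    refine hq.not_reachable_of_not_adj (c := c) (fun x y hxy => ?_) (by omega) (by omega)
      (by omega)
    obtain ⟨l, m', hl, hl', h⟩ := hadj x y hxy
    have hle := (hS l).le
    refine ⟨m', by omega, ?_, h⟩
    rintro rfl
    have h₃ : a l = m' := by
      by_contra h
      exact (hS l).notMem m' (by omega) hl' hcT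
    have h₄ : b l = m' + 1 := by
      by_contra h
      exact (hS l).notMem (m' + 1) (by omega) (by omega) hcT'
    exact (hS l).not_succ (h₃ ▸ hcT) (h₄ ▸ hcT') (by omega)
  refine ⟨r, fun i => PathIn.interval hq (a i) (b i), ⟨?_, ?_, ?_, ?_, ?_, ?_, ?_⟩, ?_⟩
  · obtain ⟨m, n, hm, hn, h⟩ := IsSegmentInterval.exists_of_notMem hpos le_rfl hN
    obtain ⟨i, rfl, rfl⟩ := hsurj m n h
    have hb : b i = q.length := le_antisymm h.le hn
    have hbT : q.getVert (b i) ∉ T := hb ▸ hN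
    exact ⟨i, h.isOneTerminalSegment hq (.inl ⟨(hboth i).resolve_right hbT, hbT⟩)⟩
  · intro i j l hi hj hl
    rcases hone' i hi with ⟨hi, -⟩ | hi <;> rcases hone' j hj with ⟨hj, -⟩ | hj <;>
      rcases hone' l hl with ⟨hl, -⟩ | hl
    all_goals first
      | exact .inl (huniq0 _ _ hi hj)
      | exact .inl (huniqN _ _ hi hj)
      | exact .inr (.inl (huniq0 _ _ hi hl))
      | exact .inr (.inl (huniqN _ _ hi hl))
      | exact .inr (.inr (huniq0 _ _ hj hl))
      | exact .inr (.inr (huniqN _ _ hj hl))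
  · intro i
    by_cases ha : q.getVert (a i) ∈ T <;> by_cases hb : q.getVert (b i) ∈ T
    · exact .inr ((hS i).isTwoTerminalSegment hq ha hb)
    · exact .inl ((hS i).isOneTerminalSegment hq (.inl ⟨ha, hb⟩))
    · exact .inl ((hS i).isOneTerminalSegment hq (.inr ⟨ha, hb⟩))
    · exact ((hboth i).elim ha hb).elim
  · exact fun i j hij x hxi hxj => ⟨hdisj i j hij x hxi hxj, hdisj j i hij.symm x hxj hxi⟩
  · intro i _ x hx hxT j hji hxj
    obtain ⟨n, hn, hn', h⟩ := (hmem j x).1 hxj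
    have hi := (hS i).lt
    have hi' := (hS i).le
    have hj' := (hS j).le
    rcases (hend i x).1 hx with rfl | rfl
    · have ha := (hS i).left.resolve_left hxT
      have := hpt (by omega) (by omega) h
      exact hji (huniq0 _ _ (by omega) ha)
    · have hb := (hS i).right.resolve_left hxT
      have := hpt (by omega) (by omega) h
      exact hji (huniqN _ _ (by omega) hb)
  · refine hq.isLinearForest.anti fun x y hxy => ?_
    obtain ⟨i, m, hm, hm', h⟩ := hadj x y hxy
    have := (hS i).le
    exact q.toSubgraph_adj_iff.2 ⟨m, h, by omega⟩
  · intro i j hij hi hj x hx y hy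
    rcases hone' i hi with ⟨hi, h0⟩ | hi <;> rcases hone' j hj with ⟨hj, h0'⟩ | hj
    · exact (hij (huniq0 _ _ hi hj)).elim
    · exact hsep i j hi h0 hj hij x hx y hy
    · exact fun h => hsep j i hj h0' hi hij.symm y hy x hx h.symm
    · exact (hij (huniqN _ _ hi hj)).elim
  · rw [outsideCount]
    congr 1
    ext x
    simp only [Set.mem_sdiff, Set.mem_iUnion, Set.mem_ofPred_eq]
    refine and_congr_left fun hxT => ⟨?_, fun hx => ?_⟩
    · rintro ⟨i, hi⟩
      obtain ⟨m, -, -, rfl⟩ := (hmem i x).1 hi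
      exact q.getVert_mem_support m
    · obtain ⟨m, rfl, hm⟩ := Walk.mem_support_iff_exists_getVert.1 hx
      obtain ⟨m', n, h₁, h₂, h⟩ := IsSegmentInterval.exists_of_notMem hpos hm hxT
      obtain ⟨i, rfl, rfl⟩ := hsurj m' n h
      exact ⟨i, (hmem i _).2 ⟨m, h₁, h₂, rfl⟩⟩

theorem SimpleGraph.Walk.exists_ncard_support_take_sdiff_eq [Finite V] (q : G.Walk u v) {T : Set V}
    {p : ℕ} (hp : 1 ≤ p) (h : p ≤ ({x | x ∈ q.support} \ T).ncard) :
    ∃ t ≤ q.length, ({x | x ∈ (q.take t).support} \ T).ncard = p ∧ q.getVert t ∉ T := by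
  classical
  have hex : ∃ t, t ≤ q.length ∧ p ≤ ({x | x ∈ (q.take t).support} \ T).ncard := by
    refine ⟨q.length, le_rfl, h.trans (Set.ncard_le_ncard ?_ (Set.toFinite _))⟩
    rintro x ⟨hx, hxT⟩
    obtain ⟨i, hi, hil⟩ := Walk.mem_support_iff_exists_getVert.1 hx
    exact ⟨(Walk.mem_support_take_iff le_rfl).2 ⟨i, hil, hi⟩, hxT⟩
  obtain ⟨htl, hle⟩ := Nat.find_spec hex
  have hmin := fun j => Nat.find_min hex (m := j)
  generalize Nat.find hex = t at htl hle hmin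
  obtain ⟨A, hA, hsub⟩ : ∃ A : Set V, (A \ T).ncard < p ∧
      {x | x ∈ (q.take t).support} ⊆ insert (q.getVert t) A := by
    rcases Nat.eq_zero_or_pos t with rfl | ht
    · refine ⟨∅, by simpa using Nat.pos_of_ne_zero (Nat.one_le_iff_ne_zero.1 hp), fun x hx => ?_⟩
      obtain ⟨i, hi, rfl⟩ := (Walk.mem_support_take_iff htl).1 hx
      exact .inl (by rw [Nat.le_zero.1 hi])
    · refine ⟨{x | x ∈ (q.take (t - 1)).support}, ?_, fun x hx => ?_⟩
      · have := hmin (t - 1) (by omega)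
        push Not at this
        exact this (by omega)
      · obtain ⟨i, hi, rfl⟩ := (Walk.mem_support_take_iff htl).1 hx
        rcases hi.eq_or_lt with rfl | hi
        · exact .inl rfl
        · exact .inr ((Walk.mem_support_take_iff (by omega)).2 ⟨i, by omega, rfl⟩)
  have hT : q.getVert t ∉ T := by
    intro hT
    refine (hle.trans (Set.ncard_le_ncard ?_ (Set.toFinite _))).not_gt hA
    rintro x ⟨hx, hxT⟩
    exact ⟨(hsub hx).resolve_left fun h => hxT (h ▸ hT), hxT⟩
  refine ⟨t, htl, le_antisymm ?_ hle, hT⟩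
  have : ({x | x ∈ (q.take t).support} \ T).ncard ≤ (insert (q.getVert t) (A \ T)).ncard := by
    refine Set.ncard_le_ncard ?_ (Set.toFinite _)
    rintro x ⟨hx, hxT⟩
    exact (hsub hx).imp_right fun h => ⟨h, hxT⟩
  have := Set.ncard_insert_le (q.getVert t) (A \ T)
  omega

theorem SimpleGraph.Walk.IsPath.exists_isExtendedSegmentSystem_of_start_mem [Finite V]
    (hq : q.IsPath) {T : Set V} (hu : u ∈ T) {p : ℕ} (hp : 1 ≤ p)
    (h : p ≤ ({x | x ∈ q.support} \ T).ncard) :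
    ∃ (r : ℕ) (P : Fin r → PathIn G), IsExtendedSegmentSystem G T P ∧ outsideCount T P = p := by
  obtain ⟨t, -, hout, htT⟩ := q.exists_ncard_support_take_sdiff_eq hp h
  rw [← hout]
  exact (hq.take t).exists_isExtendedSegmentSystem htT ⟨0, by omega, by rwa [Walk.getVert_zero]⟩
    (.inl hu)

theorem SimpleGraph.Walk.IsPath.append {w : V} (hq : q.IsPath) {q' : G.Walk v w} (hq' : q'.IsPath)
    (h : ∀ x ∈ q.support, x ∈ q'.support → x = v) : (q.append q').IsPath := by
  refine IsPath.mk' ?_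
  rw [Walk.support_append]
  refine hq.support_nodup.append hq'.support_nodup.tail fun x hx hx' => ?_
  have := hq'.mem_tail_support_iff.1 hx'
  exact this.2 (h x hx this.1)

theorem SimpleGraph.Connected.exists_isPath_start_of_disjoint [Finite V] (hG : G.Connected)
    (hq : q.IsPath) (z : V) : ∃ (w : V) (R : G.Walk z w), R.IsPath ∧
      q.length + 2 ≤ 2 * ({x | x ∈ R.support} ∩ {x | x ∈ q.support}).ncard := by
  classical
  obtain ⟨W, hW⟩ := (hG z u).exists_isPath
  have hex : ∃ m, m ≤ W.length ∧ W.getVert m ∈ q.support :=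
    ⟨W.length, le_rfl, by rw [W.getVert_length]; exact q.start_mem_support⟩
  obtain ⟨hml, hm⟩ := Nat.find_spec hex
  have hmin := fun j => Nat.find_min hex (m := j)
  generalize Nat.find hex = m at hml hm hmin
  have key : ∀ {w : V} (S : G.Walk (W.getVert m) w), S.IsPath → S.support ⊆ q.support →
      ∃ (w : V) (R : G.Walk z w), R.IsPath ∧
        S.length + 1 ≤ ({x | x ∈ R.support} ∩ {x | x ∈ q.support}).ncard := by
    intro w S hS hsub
    refine ⟨w, (W.take m).append S, (hW.take m).append hS fun x hx hxS => ?_, ?_⟩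
    · obtain ⟨i, hi, rfl⟩ := (Walk.mem_support_take_iff hml).1 hx
      rcases hi.eq_or_lt with rfl | hi
      · rfl
      · exact (hmin i hi ⟨by omega, hsub hxS⟩).elim
    · rw [← S.length_support, ← List.toFinset_card_of_nodup hS.support_nodup,
        ← Set.ncard_coe_finset]
      refine Set.ncard_le_ncard (fun x hx => ?_) (Set.toFinite _)
      rw [List.coe_toFinset] at hx
      exact ⟨Walk.support_subset_support_append_right _ _ hx, hsub hx⟩
  have hlen : (q.takeUntil _ hm).length + (q.dropUntil _ hm).length = q.length := by
    rw [← Walk.length_append, q.take_spec hm]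
  rcases le_total (q.takeUntil _ hm).length (q.dropUntil _ hm).length with h | h
  · obtain ⟨w, R, hR, hle⟩ := key (q.dropUntil _ hm) (hq.dropUntil hm)
      (q.support_dropUntil_subset_support hm)
    exact ⟨w, R, hR, by omega⟩
  · obtain ⟨w, R, hR, hle⟩ := key (q.takeUntil _ hm).reverse (hq.takeUntil hm).reverse
      (fun x hx => q.support_takeUntil_subset_support hm (by simpa using hx))
    rw [Walk.length_reverse] at hle
    exact ⟨w, R, hR, by omega⟩

theorem SimpleGraph.Walk.IsPath.exists_succ_mem_of_ncard_lt [Finite V] (hq : q.IsPath) {T : Set V}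
    {m : ℕ} (hm : m ≤ q.length) (hlast : ∀ i, m < i → i ≤ q.length → q.getVert i ∉ T)
    (hlt : ({x | x ∈ (q.take m).support} \ T).ncard + 1 < ({x | x ∈ q.support} ∩ T).ncard) :
    ∃ c < m, q.getVert c ∈ T ∧ q.getVert (c + 1) ∈ T := by
  by_contra! hno
  refine hlt.not_ge ?_
  have h₁ : ({x | x ∈ q.support} ∩ T) ⊆
      insert (q.getVert m) (q.getVert '' {i | i < m ∧ q.getVert i ∈ T}) := by
    rintro x ⟨hx, hxT⟩
    obtain ⟨i, rfl, hi⟩ := Walk.mem_support_iff_exists_getVert.1 hx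
    rcases lt_trichotomy i m with him | rfl | him
    · exact .inr ⟨i, ⟨him, hxT⟩, rfl⟩
    · exact .inl rfl
    · exact (hlast i him hi hxT).elim
  have hfin : {i | i < m ∧ q.getVert i ∈ T}.Finite := (Set.finite_Iio m).subset fun i hi => hi.1
  have h₂ : {i | i < m ∧ q.getVert i ∈ T}.ncard ≤
      ({x | x ∈ (q.take m).support} \ T).ncard := by
    refine Set.ncard_le_ncard_of_injOn (fun i => q.getVert (i + 1)) (fun i hi => ?_)
      (fun i hi j hj hij => ?_) (Set.toFinite _)
    · exact ⟨(Walk.mem_support_take_iff hm).2 ⟨i + 1, hi.1, rfl⟩, hno i hi.1 hi.2⟩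
    · have h₁ := hi.1
      have h₂ := hj.1
      have := (hq.getVert_eq_iff (by omega) (by omega)).1 hij
      omega
  have h₃ := Set.ncard_le_ncard h₁ (Set.toFinite _)
  have h₄ := Set.ncard_insert_le (q.getVert m) (q.getVert '' {i | i < m ∧ q.getVert i ∈ T})
  have h₅ := Set.ncard_image_le (f := q.getVert) hfin
  omega

theorem SimpleGraph.Walk.IsPath.exists_isExtendedSegmentSystem_of_length [Finite V]
    (hG : G.Connected) (hq : q.IsPath) {T : Set V} (hT : T.Nonempty) {p : ℕ} (hp : 1 ≤ p)
    (hlen : p + T.ncard ≤ q.length + 1) (hpT : 2 * p ≤ T.ncard) :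
    ∃ (r : ℕ) (P : Fin r → PathIn G), IsExtendedSegmentSystem G T P ∧ outsideCount T P = p := by
  classical
  have hcard : ({x | x ∈ q.support}).ncard = q.length + 1 := by
    rw [← q.length_support, ← List.toFinset_card_of_nodup hq.support_nodup,
      ← Set.ncard_coe_finset, List.coe_toFinset]
  have hsplit := Set.ncard_inter_add_ncard_sdiff_eq_ncard {x | x ∈ q.support} T (Set.toFinite _)
  by_cases hdisj : ∀ x ∈ q.support, x ∉ T
  · obtain ⟨z, hz⟩ := hT
    obtain ⟨w, R, hR, hle⟩ := hG.exists_isPath_start_of_disjoint hq z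
    refine hR.exists_isExtendedSegmentSystem_of_start_mem hz hp ?_
    have : ({x | x ∈ R.support} ∩ {x | x ∈ q.support}).ncard ≤ ({x | x ∈ R.support} \ T).ncard :=
      Set.ncard_le_ncard (fun x hx => ⟨hx.1, hdisj x hx.2⟩) (Set.toFinite _)
    omega
  push Not at hdisj
  obtain ⟨x, hx, hxT⟩ := hdisj
  obtain ⟨i, rfl, hi⟩ := Walk.mem_support_iff_exists_getVert.1 hx
  have hm := Nat.findGreatest_le (P := fun j => q.getVert j ∈ T) q.length
  have hmT := Nat.findGreatest_spec (P := fun j => q.getVert j ∈ T) hi hxT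
  have hlast := fun j => Nat.findGreatest_is_greatest (P := fun j => q.getVert j ∈ T)
    (n := q.length) (k := j)
  generalize Nat.findGreatest (fun j => q.getVert j ∈ T) q.length = m at hm hmT hlast
  by_cases hdrop : p ≤ ({x | x ∈ (q.drop m).support} \ T).ncard
  · exact (hq.drop m).exists_isExtendedSegmentSystem_of_start_mem hmT hp hdrop
  by_cases htake : p ≤ ({x | x ∈ (q.take m).support} \ T).ncard
  · refine (hq.take m).reverse.exists_isExtendedSegmentSystem_of_start_mem hmT hp ?_
    simpa only [Walk.support_reverse, List.mem_reverse] using htake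
  have hcover : {x | x ∈ q.support} \ T ⊆
      ({x | x ∈ (q.take m).support} \ T) ∪ ({x | x ∈ (q.drop m).support} \ T) := by
    rintro x ⟨hx, hxT⟩
    obtain ⟨j, rfl, hj⟩ := Walk.mem_support_iff_exists_getVert.1 hx
    rcases le_total j m with h | h
    · exact .inl ⟨(Walk.mem_support_take_iff hm).2 ⟨j, h, rfl⟩, hxT⟩
    · exact .inr ⟨(Walk.mem_support_drop_iff hm).2 ⟨j, h, hj, rfl⟩, hxT⟩
  have h₁ := Set.ncard_le_ncard hcover (Set.toFinite _)
  have h₂ := Set.ncard_union_le ({x | x ∈ (q.take m).support} \ T)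
    ({x | x ∈ (q.drop m).support} \ T)
  have hinter : ({x | x ∈ q.support} ∩ T).ncard ≤ T.ncard :=
    Set.ncard_le_ncard Set.inter_subset_right (Set.toFinite _)
  obtain ⟨t, htl, hout, htT⟩ := q.exists_ncard_support_take_sdiff_eq (T := T) hp (by omega)
  have hmt : m < t := by
    by_contra! hle
    refine htake (hout ▸ Set.ncard_le_ncard ?_ (Set.toFinite _))
    rintro x ⟨hx, hxT⟩
    obtain ⟨j, hj, rfl⟩ := (Walk.mem_support_take_iff htl).1 hx
    exact ⟨(Walk.mem_support_take_iff hm).2 ⟨j, by omega, rfl⟩, hxT⟩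
  obtain ⟨c, hc, hcT, hcT'⟩ := hq.exists_succ_mem_of_ncard_lt hm hlast (by omega)
  rw [← hout]
  refine (hq.take t).exists_isExtendedSegmentSystem htT ⟨m, ?_, ?_⟩ (.inr ⟨c, ?_, ?_, ?_⟩)
  · rw [Walk.take_length]
    omega
  · rwa [Walk.take_getVert, inf_eq_right.2 hmt.le]
  · rw [Walk.take_length]
    omega
  · rwa [Walk.take_getVert, inf_eq_right.2 (by omega)]
  · rwa [Walk.take_getVert, inf_eq_right.2 (by omega)]

end PathInterval

/-- Let `d, k ≥ 1`, and let `G` be a connected graph with a `d`-core `H` such that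
`d ≥ 5k - 3` and `d > |V(H)| - k` (i.e. `|V(H)| < d + k`). Then `G` has a path with at
least `d + k` vertices iff `G` has an extended system of `V(H)`-segments whose total
number of vertices outside `V(H)` equals `p = d + k - |V(H)|`. -/
theorem path_iff_extendedSegmentSystem {V : Type*} [Fintype V] (G : SimpleGraph V)
    (d k : ℕ) (hd : 1 ≤ d) (hk : 1 ≤ k) (hconn : G.Connected)
    (H : Set V) (hcore : IsDCore G d H)
    (hdk : 5 * k - 3 ≤ d) (hsmall : H.ncard < d + k) :
    (∃ (u v : V) (q : G.Walk u v), q.IsPath ∧ d + k ≤ q.support.length) ↔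
    (∃ (r : ℕ) (P : Fin r → PathIn G), IsExtendedSegmentSystem G H P ∧
      outsideCount H P = d + k - H.ncard) := by
  have hfin : H.Finite := Set.toFinite H
  have hne : H.Nonempty := Set.nonempty_coe_sort.1 hcore.1.nonempty
  have hlt : d < H.ncard := by
    obtain ⟨v, hv⟩ := hne
    refine (hcore.2.1 v hv).trans_lt (Set.ncard_lt_ncard ⟨Set.inter_subset_right, fun h => ?_⟩ hfin)
    exact G.irrefl (h hv).1
  constructor
  · rintro ⟨u, v, q, hq, hlen⟩
    rw [q.length_support] at hlen
    exact hq.exists_isExtendedSegmentSystem_of_length hconn hne (by omega) (by omega) (by omega)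
  · rintro ⟨r, P, hP, hcount⟩
    exact hP.exists_isPath_length (by omega) hcore.2.1 (by omega)
end
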